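/- For the torus control system (lifted to ℝ^d × ℝ^d) with Hamiltonians H_u(q,p) = |p|²/2 + V_0(q) + Σ_{j=1}^d (u_{2j−1} cos(k_j·q) + u_{2j} sin(k_j·q)), every vertical shear (q,p) ↦ (q, p − ∇f(q)) with f ∈ C^∞(ℝ^d, ℝ) 2π-periodic in each variable is small-time approximately reachable. -/

import Mathlib

open MeasureTheory Real

noncomputable section

/-- The phase space `T*ℝ^d = ℝ^d × ℝ^d` (positions `q` and momenta `p`),
identified with `ℝ^{2d}` with the sup norm and the Lebesgue (symplectic volume) measure. -/
abbrev Phase (d : ℕ) := (Fin d → ℝ) × (Fin d → ℝ)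

/-- The Hamiltonian vector field of a function `H : Phase d → ℝ`:
`H⃗(q,p) = (∂_p H(q,p), −∂_q H(q,p))`. -/
def hamVF {d : ℕ} (H : Phase d → ℝ) (x : Phase d) : Phase d :=
  (fun i => fderiv ℝ H x (0, Pi.single i 1),
   fun i => -(fderiv ℝ H x (Pi.single i 1, 0)))

/-- `φ` is the global flow of the (complete) vector field `X`. -/
def IsFlowOf {d : ℕ} (X : Phase d → Phase d) (φ : ℝ → Phase d → Phase d) : Prop :=
  (∀ x, φ 0 x = x) ∧ ∀ x t, HasDerivAt (fun s => φ s x) (X (φ t x)) t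

/-- `Φ` is a smooth diffeomorphism of phase space. -/
def IsDiffeo {d : ℕ} (Φ : Phase d → Phase d) : Prop :=
  ContDiff ℝ (⊤ : ℕ∞) Φ ∧
    ∃ Ψ, ContDiff ℝ (⊤ : ℕ∞) Ψ ∧ Function.LeftInverse Ψ Φ ∧ Function.RightInverse Ψ Φ

/-- `Φ` is a Hamiltonian diffeomorphism of `T*ℝ^d`: a smooth diffeomorphism which is the
time-1 flow map of a smooth time-dependent Hamiltonian whose non-autonomous Hamiltonian flow
is defined on `[0,1]` from every initial point. -/
def IsHamDiffeo {d : ℕ} (Φ : Phase d → Phase d) : Prop :=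
  IsDiffeo Φ ∧
  ∃ (H : ℝ → Phase d → ℝ) (φ : ℝ → Phase d → Phase d),
    ContDiff ℝ (⊤ : ℕ∞) (fun z : ℝ × Phase d => H z.1 z.2) ∧
    (∀ x, φ 0 x = x) ∧
    (∀ x, ∀ t ∈ Set.Icc (0:ℝ) 1,
      HasDerivWithinAt (fun s => φ s x) (hamVF (H t) (φ t x)) (Set.Icc (0:ℝ) 1) t) ∧
    Φ = φ 1

/-- `Φ` is the flow map from time `0` to time `τ` of the time-dependent Hamiltonian vector
field `H⃗_{u(t)}` for some piecewise constant control `u(·) : [0,τ] → U` (finitely many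
pieces): i.e. `Φ` is a finite composition of flows of the autonomous fields `H⃗_{u_i}`
for nonnegative durations summing to `τ`. -/
def Reachable {d : ℕ} {U : Type*} (Ham : U → Phase d → ℝ) (τ : ℝ)
    (Φ : Phase d → Phase d) : Prop :=
  ∃ (n : ℕ) (dur : Fin n → ℝ) (u : Fin n → U) (φ : Fin n → ℝ → Phase d → Phase d),
    (∀ i, 0 ≤ dur i) ∧ (∑ i, dur i) = τ ∧
    (∀ i, IsFlowOf (hamVF (Ham (u i))) (φ i)) ∧
    Φ = (List.ofFn (fun i => φ i (dur i))).foldl (fun g f => f ∘ g) id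

/-- `‖Φ − Ψ‖_{C^ℓ(K)} < ε`: all iterated derivatives of the difference up to order `ℓ`
are smaller than `ε` on `K`. -/
def CloseCl {d : ℕ} (ℓ : ℕ) (K : Set (Phase d)) (ε : ℝ) (Φ Ψ : Phase d → Phase d) : Prop :=
  ∀ j ≤ ℓ, ∀ x ∈ K, ‖iteratedFDeriv ℝ j (fun y => Φ y - Ψ y) x‖ < ε

/-- `Ψ ∈ R̄_st`: the diffeomorphism `Ψ` is small-time approximately reachable for the
control system with controlled Hamiltonians `Ham u`, `u ∈ U`. -/
def SmallTimeReachable {d : ℕ} {U : Type*} (Ham : U → Phase d → ℝ)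
    (Ψ : Phase d → Phase d) : Prop :=
  ∀ ε > 0, ∀ K : Set (Phase d), IsCompact K → ∀ ℓ : ℕ,
    ∃ τ ∈ Set.Icc (0:ℝ) ε, ∃ Φ, Reachable Ham τ Φ ∧ CloseCl ℓ K ε Φ Ψ

/-- A function `f` with complete Hamiltonian vector field is STAR (small-time approximately
reachable) if its flow at every time `s ∈ ℝ` belongs to `R̄_st`. -/
def IsSTAR {d : ℕ} {U : Type*} (Ham : U → Phase d → ℝ) (f : Phase d → ℝ) : Prop :=
  (∃ φ, IsFlowOf (hamVF f) φ) ∧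
  ∀ φ, IsFlowOf (hamVF f) φ → ∀ s : ℝ, SmallTimeReachable Ham (φ s)

/-- The Poisson bracket `{f,g} = Σ_j (∂_{p_j} f ∂_{q_j} g − ∂_{q_j} f ∂_{p_j} g)`. -/
def poissonBracket {d : ℕ} (f g : Phase d → ℝ) : Phase d → ℝ :=
  fun x => ∑ j, (fderiv ℝ f x (0, Pi.single j 1) * fderiv ℝ g x (Pi.single j 1, 0)
      - fderiv ℝ f x (Pi.single j 1, 0) * fderiv ℝ g x (0, Pi.single j 1))

/-- The mechanical Hamiltonian `H_u(q,p) = |p|²/2 + V_0(q) + Σ_j u_j V_j(q)`. -/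
def mechHam {d m : ℕ} (V0 : (Fin d → ℝ) → ℝ) (V : Fin m → (Fin d → ℝ) → ℝ)
    (u : Fin m → ℝ) : Phase d → ℝ :=
  fun x => (∑ i, (x.2 i) ^ 2) / 2 + V0 x.1 + ∑ j, u j * V j x.1

/-- The Euclidean controlled Hamiltonian
`H_u(q,p) = |p|²/2 + V_0(q) + Σ_{j=1}^d u_j q_j + u_{d+1} e^{−|q|²/2}`,
with control `u ∈ ℝ^d × ℝ ≃ ℝ^{d+1}`. -/
def eucHam {d : ℕ} (V0 : (Fin d → ℝ) → ℝ) (u : (Fin d → ℝ) × ℝ) : Phase d → ℝ :=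
  fun x => (∑ i, (x.2 i) ^ 2) / 2 + V0 x.1 + (∑ j, u.1 j * x.1 j)
    + u.2 * Real.exp (-(∑ i, (x.1 i) ^ 2) / 2)

/-- The frequencies `k_1 = e_1, …, k_{d−1} = e_{d−1}, k_d = (1,…,1)`. -/
def kvec (d : ℕ) (j : Fin d) : Fin d → ℝ :=
  if (j : ℕ) < d - 1 then Pi.single j 1 else fun _ => 1

/-- The torus controlled Hamiltonian (lifted to `ℝ^d × ℝ^d`)
`H_u(q,p) = |p|²/2 + V_0(q) + Σ_{j=1}^d (u_{2j−1} cos(k_j·q) + u_{2j} sin(k_j·q))`,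
with control `u ∈ (ℝ²)^d ≃ ℝ^{2d}`. -/
def torusHam {d : ℕ} (V0 : (Fin d → ℝ) → ℝ) (u : Fin d → ℝ × ℝ) : Phase d → ℝ :=
  fun x => (∑ i, (x.2 i) ^ 2) / 2 + V0 x.1 +
    ∑ j, ((u j).1 * Real.cos (∑ i, kvec d j i * x.1 i) +
          (u j).2 * Real.sin (∑ i, kvec d j i * x.1 i))

/-- The vertical shear `(q,p) ↦ (q, p − ∇f(q))`. -/
def vshear {d : ℕ} (f : (Fin d → ℝ) → ℝ) : Phase d → Phase d :=
  fun x => (x.1, fun i => x.2 i - fderiv ℝ f x.1 (Pi.single i 1))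

/-- The horizontal shear `(q,p) ↦ (q + ∇g(p), p)`. -/
def hshear {d : ℕ} (g : (Fin d → ℝ) → ℝ) : Phase d → Phase d :=
  fun x => (fun i => x.1 i + fderiv ℝ g x.2 (Pi.single i 1), x.2)

/-- `M` is a mesh of size `h`: the closed sup-norm cubes `C̄(m_n,h)` cover `ℝ^{2d}` and the
open cubes `C(m_n,h)` are pairwise disjoint. -/
def IsMesh {d : ℕ} (h : ℝ) (M : ℕ → Phase d) : Prop :=
  (∀ x : Phase d, ∃ n, ‖x - M n‖ ≤ h) ∧
  ∀ n ℓ : ℕ, n ≠ ℓ →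
    Disjoint {x : Phase d | ‖x - M n‖ < h} {x : Phase d | ‖x - M ℓ‖ < h}

/-- `F` is a permutation of the mesh `M` of size `h`: a bijection translating every open
cube of the mesh onto another one. -/
def IsMeshPermutation {d : ℕ} (h : ℝ) (M : ℕ → Phase d) (F : Phase d → Phase d) : Prop :=
  Function.Bijective F ∧
  ∀ n : ℕ, ∃ ℓ : ℕ, ∀ x : Phase d, ‖x - M n‖ < h → F x = x + (M ℓ - M n)

/-- The fundamental domain `Q = [0,2π)^d × ℝ^d` of `T*𝕋^d` in `ℝ^d × ℝ^d`. -/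
def torusBlock (d : ℕ) : Set (Phase d) :=
  {x : Phase d | ∀ i, 0 ≤ x.1 i ∧ x.1 i < 2 * Real.pi}

/-- A torus density of class `L^r`: a measurable function on `ℝ^d × ℝ^d`, `2π`-periodic in
each position variable, with finite `L^r` norm on the fundamental domain `Q`. -/
def IsTorusDensity {d : ℕ} (p : ENNReal) (ρ : Phase d → ℝ) : Prop :=
  Measurable ρ ∧
  (∀ (q : Fin d → ℝ) (pp : Fin d → ℝ) (k : Fin d → ℤ),
    ρ (fun i => q i + 2 * Real.pi * (k i), pp) = ρ (q, pp)) ∧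
  eLpNorm ρ p (volume.restrict (torusBlock d)) < ⊤

end

open MeasureTheory Real
set_option linter.unusedSectionVars false
namespace TorusCtl
noncomputable section ODEPart
open Set Filter Topology
open scoped ContDiff unitInterval

variable {E F : Type} [NormedAddCommGroup E] [NormedSpace ℝ E]
  [NormedAddCommGroup F] [NormedSpace ℝ F]

/-- Superposition operator on continuous paths. -/
def nem (X : E → F) (hX : Continuous X) (γ : C(I, E)) : C(I, F) :=
  (⟨X, hX⟩ : C(E, F)).comp γ

@[simp] lemma nem_apply (X : E → F) (hX : Continuous X) (γ : C(I, E)) (t : I) :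
    nem X hX γ t = X (γ t) := rfl

lemma nem_continuous (X : E → F) (hX : Continuous X) : Continuous (nem X hX) :=
  ContinuousMap.continuous_postcomp _

/-- Pointwise application of operator-valued paths. -/
def papp : C(I, E →L[ℝ] F) →L[ℝ] C(I, E) →L[ℝ] C(I, F) :=
  LinearMap.mkContinuous₂
    (LinearMap.mk₂ ℝ (fun (A : C(I, E →L[ℝ] F)) (h : C(I, E)) => (⟨fun t => A t (h t), by fun_prop⟩ : C(I, F)))
      (by intros; ext; simp) (by intros; ext; simp) (by intros; ext; simp)
      (by intros; ext; simp)) 1 (by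
      intro A h
      rw [ContinuousMap.norm_le _ (by positivity)]
      intro t
      simp only [LinearMap.mk₂_apply, ContinuousMap.coe_mk, one_mul]
      exact ((A t).le_opNorm _).trans
        (mul_le_mul (A.norm_coe_le_norm t) (h.norm_coe_le_norm t) (norm_nonneg _) (by positivity)))

@[simp] lemma papp_apply (A : C(I, E →L[ℝ] F)) (h : C(I, E)) (t : I) :
    papp A h t = A t (h t) := rfl

lemma nem_hasFDerivAt (X : E → F) (hX : ContDiff ℝ 1 X) (γ : C(I, E)) :
    HasFDerivAt (nem X hX.continuous)
      (papp (nem (fderiv ℝ X) (hX.continuous_fderiv one_ne_zero) γ)) γ := by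
  rw [hasFDerivAt_iff_isLittleO_nhds_zero, Asymptotics.isLittleO_iff]
  intro ε hε
  have hc := (nem_continuous (fderiv ℝ X) (hX.continuous_fderiv one_ne_zero)).continuousAt (x := γ)
  rw [Metric.continuousAt_iff] at hc
  obtain ⟨δ, hδ, hc⟩ := hc ε hε
  filter_upwards [Metric.ball_mem_nhds (0 : C(I, E)) hδ] with h hh
  rw [ContinuousMap.norm_le _ (by positivity)]
  intro t
  have key : ∀ s ∈ Icc (0:ℝ) 1, ‖fderiv ℝ X (γ t + s • h t) - fderiv ℝ X (γ t)‖ ≤ ε := by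
    intro s hs
    have h1 : dist (γ + s • h) γ < δ := by
      rw [dist_eq_norm, add_sub_cancel_left, norm_smul]
      have : ‖s‖ ≤ 1 := by rw [Real.norm_eq_abs, abs_le]; constructor <;> linarith [hs.1, hs.2]
      have h2 : ‖h‖ < δ := by simpa using hh
      calc ‖s‖ * ‖h‖ ≤ 1 * ‖h‖ := by gcongr
        _ < δ := by linarith
    have h2 := hc h1
    rw [dist_eq_norm] at h2
    have h3 := ContinuousMap.norm_coe_le_norm (nem (fderiv ℝ X) (hX.continuous_fderiv one_ne_zero) (γ + s • h) - nem (fderiv ℝ X) (hX.continuous_fderiv one_ne_zero) γ) t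
    exact h3.trans h2.le
  have mv := (convex_segment (γ t) (γ t + h t)).norm_image_sub_le_of_norm_fderiv_le'
    (f := X) (φ := fderiv ℝ X (γ t)) (C := ε) (x := γ t) (y := γ t + h t)
    (fun x _ => (hX.differentiable one_ne_zero) x)
    (by
      intro x hx
      rw [segment_eq_image'] at hx
      obtain ⟨s, hs, rfl⟩ := hx
      have := key s hs
      simpa using this) (left_mem_segment _ _ _) (right_mem_segment _ _ _)
  simp only [add_sub_cancel_left] at mv
  calc _ ≤ ε * ‖h t‖ := by simpa using mv
    _ ≤ ε * ‖h‖ := by gcongr; exact h.norm_coe_le_norm t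

lemma nem_contDiff_nat (n : ℕ) : ∀ {F : Type} [NormedAddCommGroup F] [NormedSpace ℝ F]
    (X : E → F) (hX : ContDiff ℝ n X), ContDiff ℝ n (nem X hX.continuous) := by
  induction n with
  | zero =>
    intro F _ _ X hX
    simpa [contDiff_zero] using nem_continuous X hX.continuous
  | succ n ih =>
    intro F _ _ X hX
    have hX' : ContDiff ℝ ((n : WithTop ℕ∞) + 1) X := by simpa using hX
    have h1 : ContDiff ℝ 1 X := hX.of_le (by simp)
    have h2 : ContDiff ℝ n (fderiv ℝ X) := hX.fderiv_right (by simp)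
    push_cast
    rw [contDiff_succ_iff_hasFDerivAt]
    have hp : ContDiff ℝ n (fun A : C(I, E →L[ℝ] F) => (papp A : C(I, E) →L[ℝ] C(I, F))) :=
      (IsBoundedLinearMap.mk ⟨papp.map_add, papp.map_smul⟩ ⟨1, one_pos, fun A => by
        refine ContinuousLinearMap.opNorm_le_bound _ (by positivity) fun h => ?_
        rw [ContinuousMap.norm_le _ (by positivity), one_mul]
        intro t
        exact ((A t).le_opNorm _).trans
          (mul_le_mul (A.norm_coe_le_norm t) (h.norm_coe_le_norm t) (norm_nonneg _)
            (by positivity))⟩ : IsBoundedLinearMap ℝ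
          (fun A : C(I, E →L[ℝ] F) => (papp A : C(I, E) →L[ℝ] C(I, F)))).contDiff
    exact ⟨fun γ => papp (nem (fderiv ℝ X) h2.continuous γ),
      hp.comp (ih _ h2), fun γ => nem_hasFDerivAt X h1 γ⟩

lemma nem_contDiff (X : E → F) (hX : ContDiff ℝ ∞ X) :
    ContDiff ℝ ∞ (nem X hX.continuous) := by
  rw [contDiff_infty]
  intro n
  exact nem_contDiff_nat n X (hX.of_le (by exact_mod_cast le_top))

lemma ext_continuous (γ : C(I, E)) : Continuous (IccExtend (zero_le_one' ℝ) γ) :=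
  γ.continuous.Icc_extend'

variable [CompleteSpace E]

/-- Volterra integration operator. -/
def volt : C(I, E) →L[ℝ] C(I, E) :=
  LinearMap.mkContinuous
    { toFun := fun γ => ⟨fun t => ∫ s in (0:ℝ)..t, IccExtend (zero_le_one' ℝ) γ s, by
        have := intervalIntegral.continuous_primitive
          (fun a b => (ext_continuous γ).intervalIntegrable (μ := volume) a b) 0
        fun_prop⟩
      map_add' := by
        intro a b; ext t
        simp only [ContinuousMap.coe_mk, ContinuousMap.add_apply]
        rw [← intervalIntegral.integral_add ((ext_continuous a).intervalIntegrable _ _)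
          ((ext_continuous b).intervalIntegrable _ _)]
        rfl
      map_smul' := by
        intro c a; ext t
        simp only [ContinuousMap.coe_mk, ContinuousMap.smul_apply, RingHom.id_apply]
        rw [← intervalIntegral.integral_smul]
        rfl } 1 (by
      intro γ
      rw [ContinuousMap.norm_le _ (by positivity)]
      intro t
      simp only [LinearMap.coe_mk, AddHom.coe_mk, ContinuousMap.coe_mk]
      have := intervalIntegral.norm_integral_le_of_norm_le_const (a := (0:ℝ)) (b := t)
        (f := IccExtend (zero_le_one' ℝ) γ) (C := ‖γ‖) (fun s _ => γ.norm_coe_le_norm _)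
      refine this.trans ?_
      rw [mul_comm]
      gcongr
      rw [sub_zero, abs_of_nonneg t.2.1]; exact t.2.2)

lemma volt_apply (γ : C(I, E)) (t : I) :
    volt γ t = ∫ s in (0:ℝ)..t, IccExtend (zero_le_one' ℝ) γ s := rfl

lemma volt_iter (A : C(I, E →L[ℝ] E)) (h : C(I, E)) (n : ℕ) (t : I) :
    ‖((volt ∘L papp A) ^ n) h t‖ ≤ (‖A‖ ^ n * (t:ℝ) ^ n / n.factorial) * ‖h‖ := by
  induction n generalizing t with
  | zero => simpa using h.norm_coe_le_norm t
  | succ n ih =>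
    rw [pow_succ', mul_apply_eq_comp, ContinuousLinearMap.comp_apply, volt_apply]
    set g := ((volt ∘L papp A) ^ n) h
    have h1 : ∀ s ∈ Icc (0:ℝ) t, ‖IccExtend (zero_le_one' ℝ) (papp A g) s‖ ≤
        (‖A‖ ^ (n + 1) / n.factorial * ‖h‖) * s ^ n := by
      intro s hs
      have hs1 : s ∈ Icc (0:ℝ) 1 := ⟨hs.1, hs.2.trans t.2.2⟩
      rw [IccExtend_of_mem _ _ hs1, papp_apply]
      calc _ ≤ ‖A ⟨s, hs1⟩‖ * ‖g ⟨s, hs1⟩‖ := (A _).le_opNorm _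
        _ ≤ ‖A‖ * ((‖A‖ ^ n * s ^ n / n.factorial) * ‖h‖) := by
          gcongr
          · exact A.norm_coe_le_norm _
          · exact ih _
        _ = _ := by ring
    have h2 := intervalIntegral.norm_integral_le_of_norm_le (μ := volume) (a := (0:ℝ)) (b := t)
      (f := IccExtend (zero_le_one' ℝ) (papp A g))
      (g := fun s => (‖A‖ ^ (n + 1) / n.factorial * ‖h‖) * s ^ n) t.2.1
      (Filter.Eventually.of_forall fun s hs => h1 s ⟨hs.1.le, hs.2⟩)
      (by apply Continuous.intervalIntegrable; fun_prop)
    refine h2.trans (le_of_eq ?_)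
    rw [intervalIntegral.integral_const_mul, integral_pow, Nat.factorial_succ]
    push_cast
    have : (n.factorial : ℝ) ≠ 0 := by positivity
    have : ((n : ℝ) + 1) ≠ 0 := by positivity
    field_simp
    simp

lemma volt_isUnit (A : C(I, E →L[ℝ] E)) :
    IsUnit (1 - (volt ∘L papp A) : C(I, E) →L[ℝ] C(I, E)) := by
  set T : C(I, E) →L[ℝ] C(I, E) := volt ∘L papp A
  have hlim : Tendsto (fun n : ℕ => ‖A‖ ^ n / n.factorial) atTop (𝓝 0) :=
    FloorSemiring.tendsto_pow_div_factorial_atTop _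
  obtain ⟨n, hn⟩ := (hlim.eventually (gt_mem_nhds (zero_lt_one))).exists
  have hT : ‖T ^ n‖ < 1 := by
    refine lt_of_le_of_lt ?_ hn
    refine ContinuousLinearMap.opNorm_le_bound _ (by positivity) fun h => ?_
    rw [ContinuousMap.norm_le _ (by positivity)]
    intro t
    refine (volt_iter A h n t).trans ?_
    gcongr
    exact mul_le_of_le_one_right (by positivity) (pow_le_one₀ t.2.1 t.2.2)
  have hu : IsUnit (1 - T ^ n) := (Units.oneSub (T ^ n) hT).isUnit
  have hcomm : Commute (1 - T) (∑ i ∈ Finset.range n, T ^ i) := by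
    apply Commute.sum_right
    intro i _
    exact ((Commute.one_left _).sub_left ((Commute.refl T).pow_right i))
  rw [← mul_neg_geom_sum] at hu
  exact (hcomm.isUnit_mul_iff.1 hu).1

/-- `y` is the end point of a solution over `[0,1]` starting at `x`. -/
def Sol (X : E → E) (x y : E) : Prop :=
  ∃ c : ℝ → E, c 0 = x ∧ c 1 = y ∧
    ∀ t ∈ Icc (0:ℝ) 1, HasDerivWithinAt c (X (c t)) (Icc (0:ℝ) 1) t

lemma Sol.unique [FiniteDimensional ℝ E] {X : E → E} (hX : ContDiff ℝ ∞ X) {x y z : E}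
    (h1 : Sol X x y) (h2 : Sol X x z) : y = z := by
  obtain ⟨c, c0, c1, hc⟩ := h1
  obtain ⟨b, b0, b1, hb⟩ := h2
  have hcc : ContinuousOn c (Icc 0 1) := fun t ht => (hc t ht).continuousWithinAt
  have hbc : ContinuousOn b (Icc 0 1) := fun t ht => (hb t ht).continuousWithinAt
  have hK := (isCompact_Icc.image_of_continuousOn hcc).union (isCompact_Icc.image_of_continuousOn hbc)
  obtain ⟨R, hR⟩ := hK.isBounded.subset_closedBall 0
  obtain ⟨K, hKL⟩ := ContDiffOn.exists_lipschitzOnWith (hX.contDiffOn (s := Metric.closedBall 0 R))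
    (by simp) (convex_closedBall _ _) (isCompact_closedBall _ _)
  have := ODE_solution_unique_of_mem_Icc_right (v := fun _ => X) (s := fun _ => Metric.closedBall 0 R)
    (K := K) (f := c) (g := b) (a := 0) (b := 1) (fun _ _ => hKL) hcc
    (fun t ht => (hc t ⟨ht.1, ht.2.le⟩).mono_of_mem_nhdsWithin (Icc_mem_nhdsGE_of_mem ht))
    (fun t ht => hR (Or.inl ⟨t, ⟨ht.1, ht.2.le⟩, rfl⟩)) hbc
    (fun t ht => (hb t ⟨ht.1, ht.2.le⟩).mono_of_mem_nhdsWithin (Icc_mem_nhdsGE_of_mem ht))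
    (fun t ht => hR (Or.inr ⟨t, ⟨ht.1, ht.2.le⟩, rfl⟩)) (by rw [c0, b0])
  rw [← c1, ← b1]
  exact this ⟨zero_le_one, le_rfl⟩

/-- path to integral equation -/
lemma sol_of_integral {X : E → E} (hX : Continuous X) {x : E} {γ : C(I, E)}
    (h : γ = ContinuousMap.const I x + volt (nem X hX γ)) : Sol X x (γ 1) := by
  have hval : ∀ t : I, γ t = x + ∫ s in (0:ℝ)..t, IccExtend (zero_le_one' ℝ) (nem X hX γ) s := by
    intro t
    have := congrArg (fun f : C(I, E) => f t) h
    simpa [volt_apply] using this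
  refine ⟨IccExtend (zero_le_one' ℝ) γ, ?_, ?_, ?_⟩
  · have := hval 0
    rw [IccExtend_left]; simpa using this
  · rw [IccExtend_right]; rfl
  · intro t ht
    have hd : HasDerivAt (fun t => x + ∫ s in (0:ℝ)..t, IccExtend (zero_le_one' ℝ) (nem X hX γ) s)
        (IccExtend (zero_le_one' ℝ) (nem X hX γ) t) t := by
      apply HasDerivAt.const_add
      exact ((ext_continuous _).integral_hasStrictDerivAt _ _).hasDerivAt
    have e1 : X (IccExtend (zero_le_one' ℝ) γ t) = IccExtend (zero_le_one' ℝ) (nem X hX γ) t := by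
      rw [IccExtend_of_mem _ _ ht, IccExtend_of_mem _ _ ht]; rfl
    rw [e1]
    refine hd.hasDerivWithinAt.congr ?_ ?_
    · intro s hs
      rw [IccExtend_of_mem _ _ hs]; exact hval ⟨s, hs⟩
    · rw [IccExtend_of_mem _ _ ht]; exact hval ⟨t, ht⟩

lemma integral_of_sol {X : E → E} (hX : Continuous X) {x y : E} (h : Sol X x y) :
    ∃ γ : C(I, E), γ = ContinuousMap.const I x + volt (nem X hX γ) ∧ γ 1 = y := by
  obtain ⟨c, c0, c1, hc⟩ := h
  have hcc : ContinuousOn c (Icc 0 1) := fun t ht => (hc t ht).continuousWithinAt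
  refine ⟨⟨fun t => c t, hcc.comp_continuous continuous_subtype_val (fun t => t.2)⟩, ?_, by simpa using c1⟩
  ext t
  simp only [ContinuousMap.coe_mk, ContinuousMap.add_apply, ContinuousMap.const_apply, volt_apply]
  have hsub : Icc (0:ℝ) t ⊆ Icc 0 1 := Icc_subset_Icc_right t.2.2
  have hft := intervalIntegral.integral_eq_sub_of_hasDeriv_right_of_le (a := (0:ℝ)) (b := t)
    (f := c) (f' := fun s => X (c s)) t.2.1 (hcc.mono hsub)
    (fun s hs => (hc s ⟨hs.1.le, hs.2.le.trans t.2.2⟩).mono_of_mem_nhdsWithin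
      (Icc_mem_nhdsGT_of_mem ⟨hs.1.le, hs.2.trans_le t.2.2⟩))
    (by
      apply ContinuousOn.intervalIntegrable
      rw [uIcc_of_le t.2.1]
      exact hX.comp_continuousOn (hcc.mono hsub))
  rw [c0] at hft
  rw [← sub_eq_iff_eq_add', ← hft]
  apply intervalIntegral.integral_congr
  intro s hs
  rw [uIcc_of_le t.2.1] at hs
  simp only
  rw [IccExtend_of_mem _ _ (hsub hs)]
  rfl

/-- Smooth dependence on initial conditions. -/
theorem flow_contDiff [FiniteDimensional ℝ E] {X : E → E} (hX : ContDiff ℝ ∞ X) {G : E → E}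
    (hG : ∀ x, Sol X x (G x)) : ContDiff ℝ ∞ G := by
  rw [contDiff_iff_contDiffAt]
  intro x0
  obtain ⟨γ0, hγ0, -⟩ := integral_of_sol hX.continuous (hG x0)
  let cst : E →L[ℝ] C(I, E) := ContinuousLinearMap.const ℝ I
  let Fm : E × C(I, E) → C(I, E) := fun z => z.2 - cst z.1 - volt (nem X hX.continuous z.2)
  have hF : ContDiff ℝ ∞ Fm := by
    have := nem_contDiff X hX
    have h2 : ContDiff ℝ ∞ (fun z : E × C(I, E) => volt (nem X hX.continuous z.2)) :=
      volt.contDiff.comp (this.comp contDiff_snd)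
    have h3 : ContDiff ℝ ∞ (fun z : E × C(I, E) => cst z.1) := cst.contDiff.comp contDiff_fst
    exact (contDiff_snd.sub h3).sub h2
  have hX1 : ContDiff ℝ 1 X := hX.of_le (by simp)
  have hinv : (fderiv ℝ Fm (x0, γ0) ∘L .inr ℝ E C(I, E)).IsInvertible := by
    have h1 : fderiv ℝ Fm (x0, γ0) ∘L .inr ℝ E C(I, E) =
        1 - volt ∘L papp (nem (fderiv ℝ X) (hX1.continuous_fderiv one_ne_zero) γ0) := by
      have hd : HasFDerivAt (fun γ => Fm (x0, γ)) (fderiv ℝ Fm (x0, γ0) ∘L .inr ℝ E C(I, E)) γ0 :=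
        (hF.differentiable (by simp) (x0, γ0)).hasFDerivAt.comp γ0 (hasFDerivAt_prodMk_right x0 γ0)
      refine hd.unique ?_
      have hv : HasFDerivAt (fun γ => volt (nem X hX.continuous γ))
          (volt ∘L papp (nem (fderiv ℝ X) (hX1.continuous_fderiv one_ne_zero) γ0)) γ0 :=
        (volt (E := E)).hasFDerivAt.comp γ0 (nem_hasFDerivAt X hX1 γ0)
      exact ((hasFDerivAt_id γ0).sub_const (cst x0)).sub hv
    rw [h1]
    obtain ⟨u, hu⟩ := volt_isUnit (nem (fderiv ℝ X) (hX1.continuous_fderiv one_ne_zero) γ0)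
    exact ⟨ContinuousLinearEquiv.ofUnit u, by rw [← hu]; rfl⟩
  have cd : ContDiffAt ℝ ∞ Fm (x0, γ0) := hF.contDiffAt
  have hS := cd.contDiffAt_implicitFunction (by simp) hinv
  have hev := cd.eventually_apply_implicitFunction (by simp) hinv
  set S := cd.implicitFunction (by simp) hinv
  have hz : Fm (x0, γ0) = 0 := by
    simp only [Fm]
    rw [sub_sub, sub_eq_zero]; exact hγ0
  have hev2 : G =ᶠ[𝓝 x0] fun x => S x 1 := by
    filter_upwards [hev] with x hx
    rw [hz] at hx
    simp only [Fm] at hx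
    rw [sub_sub, sub_eq_zero] at hx
    exact (hG x).unique hX (sol_of_integral hX.continuous hx)
  refine ContDiffAt.congr_of_eventuallyEq ?_ hev2
  exact (ContinuousMap.evalCLM ℝ (1 : I)).contDiff.contDiffAt.comp x0 hS

end ODEPart
end TorusCtl

open MeasureTheory Real
set_option linter.unusedSectionVars false
namespace TorusCtl
noncomputable section CvPart
open Set Filter Topology
open scoped ContDiff

/-- Continuous convergence (locally uniform convergence to a continuous limit). -/
def Cv0 {ι E G : Type} [TopologicalSpace E] [TopologicalSpace G] (l : Filter ι)
    (F : ι → E → G) (f : E → G) : Prop :=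
  ∀ x, Tendsto (fun z : ι × E => F z.1 z.2) (l ×ˢ 𝓝 x) (𝓝 (f x))

/-- Local `C^k` convergence. -/
def Cv {ι E : Type} [NormedAddCommGroup E] [NormedSpace ℝ E] (l : Filter ι) :
    ℕ → ∀ {G : Type} [NormedAddCommGroup G] [NormedSpace ℝ G], (ι → E → G) → (E → G) → Prop
  | 0, _, _, _, F, f => Cv0 l F f
  | k + 1, _, _, _, F, f => Cv0 l F f ∧ Cv l k (fun i => fderiv ℝ (F i)) (fderiv ℝ f)

variable {ι E : Type} [NormedAddCommGroup E] [NormedSpace ℝ E] {l : Filter ι}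
variable {G G₂ G₃ : Type} [NormedAddCommGroup G] [NormedSpace ℝ G]
variable [NormedAddCommGroup G₂] [NormedSpace ℝ G₂] [NormedAddCommGroup G₃] [NormedSpace ℝ G₃]

lemma Cv.zero {k : ℕ} {F : ι → E → G} {f : E → G} (h : Cv l k F f) : Cv0 l F f := by
  cases k with
  | zero => exact h
  | succ k => exact h.1

lemma Cv.pred {k : ℕ} : ∀ {G : Type} [NormedAddCommGroup G] [NormedSpace ℝ G]
    {F : ι → E → G} {f : E → G}, Cv l (k + 1) F f → Cv l k F f := by
  induction k with
  | zero => intro G _ _ F f h; exact h.1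
  | succ k ih => intro G _ _ F f h; exact ⟨h.1, ih h.2⟩

lemma smooth_fderiv {f : E → G} (hf : ContDiff ℝ ∞ f) : ContDiff ℝ ∞ (fderiv ℝ f) :=
  hf.fderiv_right (by simp)

lemma smooth_diff {f : E → G} (hf : ContDiff ℝ ∞ f) : Differentiable ℝ f :=
  hf.differentiable (by simp)

lemma Cv.add {k : ℕ} : ∀ {G : Type} [NormedAddCommGroup G] [NormedSpace ℝ G]
    {A B : ι → E → G} {a b : E → G},
    (∀ i, ContDiff ℝ ∞ (A i)) → (∀ i, ContDiff ℝ ∞ (B i)) → ContDiff ℝ ∞ a → ContDiff ℝ ∞ b →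
    Cv l k A a → Cv l k B b → Cv l k (fun i x => A i x + B i x) (fun x => a x + b x) := by
  induction k with
  | zero => intro G _ _ A B a b _ _ _ _ hA hB x; exact (hA x).add (hB x)
  | succ k ih =>
    intro G _ _ A B a b sA sB sa sb hA hB
    refine ⟨fun x => (hA.1 x).add (hB.1 x), ?_⟩
    have e1 : (fun i => fderiv ℝ (fun x => A i x + B i x)) =
        fun i x => fderiv ℝ (A i) x + fderiv ℝ (B i) x := by
      funext i x
      exact fderiv_fun_add (smooth_diff (sA i) x) (smooth_diff (sB i) x)
    have e2 : fderiv ℝ (fun x => a x + b x) = fun x => fderiv ℝ a x + fderiv ℝ b x := by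
      funext x
      exact fderiv_fun_add (smooth_diff sa x) (smooth_diff sb x)
    rw [e1, e2]
    exact ih (fun i => smooth_fderiv (sA i)) (fun i => smooth_fderiv (sB i))
      (smooth_fderiv sa) (smooth_fderiv sb) hA.2 hB.2

lemma Cv.const {k : ℕ} : ∀ {G : Type} [NormedAddCommGroup G] [NormedSpace ℝ G]
    {a : E → G}, ContDiff ℝ ∞ a → Cv l k (fun _ => a) a := by
  induction k with
  | zero =>
    intro G _ _ a ha x
    exact (ha.continuous.tendsto x).comp tendsto_snd
  | succ k ih =>
    intro G _ _ a ha
    exact ⟨fun x => (ha.continuous.tendsto x).comp tendsto_snd, ih (smooth_fderiv ha)⟩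

lemma Cv0.bilin (β : G →L[ℝ] G₂ →L[ℝ] G₃) {A : ι → E → G} {B : ι → E → G₂} {a : E → G}
    {b : E → G₂} (hA : Cv0 l A a) (hB : Cv0 l B b) :
    Cv0 l (fun i x => β (A i x) (B i x)) (fun x => β (a x) (b x)) := by
  intro x
  have h : Continuous (fun z : G × G₂ => β z.1 z.2) := by fun_prop
  exact (h.tendsto (a x, b x)).comp ((hA x).prodMk_nhds (hB x))

lemma Cv.bilin {k : ℕ} : ∀ {G G₂ G₃ : Type} [NormedAddCommGroup G] [NormedSpace ℝ G]
    [NormedAddCommGroup G₂] [NormedSpace ℝ G₂] [NormedAddCommGroup G₃] [NormedSpace ℝ G₃]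
    (β : G →L[ℝ] G₂ →L[ℝ] G₃) {A : ι → E → G} {B : ι → E → G₂} {a : E → G} {b : E → G₂},
    (∀ i, ContDiff ℝ ∞ (A i)) → (∀ i, ContDiff ℝ ∞ (B i)) → ContDiff ℝ ∞ a → ContDiff ℝ ∞ b →
    Cv l k A a → Cv l k B b →
    Cv l k (fun i x => β (A i x) (B i x)) (fun x => β (a x) (b x)) := by
  induction k with
  | zero => intro G G₂ G₃ _ _ _ _ _ _ β A B a b _ _ _ _ hA hB; exact Cv0.bilin β hA hB
  | succ k ih =>
    intro G G₂ G₃ _ _ _ _ _ _ β A B a b sA sB sa sb hA hB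
    refine ⟨Cv0.bilin β hA.1 hB.1, ?_⟩
    have e1 : (fun i => fderiv ℝ (fun x => β (A i x) (B i x))) =
        fun i x => β.precompR E (A i x) (fderiv ℝ (B i) x) +
          β.precompL E (fderiv ℝ (A i) x) (B i x) := by
      funext i x
      exact β.fderiv_of_bilinear (smooth_diff (sA i) x) (smooth_diff (sB i) x)
    have e2 : fderiv ℝ (fun x => β (a x) (b x)) =
        fun x => β.precompR E (a x) (fderiv ℝ b x) + β.precompL E (fderiv ℝ a x) (b x) := by
      funext x
      exact β.fderiv_of_bilinear (smooth_diff sa x) (smooth_diff sb x)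
    rw [e1, e2]
    have sβ : ∀ {H H₂ H₃ : Type} [NormedAddCommGroup H] [NormedSpace ℝ H]
      [NormedAddCommGroup H₂] [NormedSpace ℝ H₂] [NormedAddCommGroup H₃] [NormedSpace ℝ H₃]
      (β : H →L[ℝ] H₂ →L[ℝ] H₃) {p : E → H} {q : E → H₂}, ContDiff ℝ ∞ p → ContDiff ℝ ∞ q →
        ContDiff ℝ ∞ (fun x => β (p x) (q x)) := by
      intro H H₂ H₃ _ _ _ _ _ _ β p q hp hq
      exact (β.contDiff.comp hp).clm_apply hq
    refine Cv.add (fun i => sβ _ (sA i) (smooth_fderiv (sB i)))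
      (fun i => sβ _ (smooth_fderiv (sA i)) (sB i)) (sβ _ sa (smooth_fderiv sb))
      (sβ _ (smooth_fderiv sa) sb) ?_ ?_
    · exact ih _ sA (fun i => smooth_fderiv (sB i)) sa (smooth_fderiv sb) hA.pred hB.2
    · exact ih _ (fun i => smooth_fderiv (sA i)) sB (smooth_fderiv sa) sb hA.2 hB.pred

lemma Cv0.comp {A : ι → E → G} {B : ι → G → G₂} {a : E → G} {b : G → G₂}
    (hA : Cv0 l A a) (hB : Cv0 l B b) : Cv0 l (fun i x => B i (A i x)) (fun x => b (a x)) := by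
  intro x
  exact (hB (a x)).comp (tendsto_fst.prodMk (hA x))

lemma Cv.comp {k : ℕ} : ∀ {G₂ : Type} [NormedAddCommGroup G₂] [NormedSpace ℝ G₂]
    {A : ι → E → G} {B : ι → G → G₂} {a : E → G} {b : G → G₂},
    (∀ i, ContDiff ℝ ∞ (A i)) → (∀ i, ContDiff ℝ ∞ (B i)) → ContDiff ℝ ∞ a → ContDiff ℝ ∞ b →
    Cv l k A a → Cv l k B b → Cv l k (fun i x => B i (A i x)) (fun x => b (a x)) := by
  induction k with
  | zero => intro G₂ _ _ A B a b _ _ _ _ hA hB; exact Cv0.comp hA hB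
  | succ k ih =>
    intro G₂ _ _ A B a b sA sB sa sb hA hB
    refine ⟨Cv0.comp hA.1 hB.1, ?_⟩
    have e1 : (fun i => fderiv ℝ (fun x => B i (A i x))) =
        fun i x => ContinuousLinearMap.compL ℝ E G G₂ (fderiv ℝ (B i) (A i x))
          (fderiv ℝ (A i) x) := by
      funext i x
      exact fderiv_comp x (smooth_diff (sB i) _) (smooth_diff (sA i) x)
    have e2 : fderiv ℝ (fun x => b (a x)) =
        fun x => ContinuousLinearMap.compL ℝ E G G₂ (fderiv ℝ b (a x)) (fderiv ℝ a x) := by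
      funext x
      exact fderiv_comp x (smooth_diff sb _) (smooth_diff sa x)
    rw [e1, e2]
    exact Cv.bilin _ (fun i => (smooth_fderiv (sB i)).comp (sA i)) (fun i => smooth_fderiv (sA i))
      ((smooth_fderiv sb).comp sa) (smooth_fderiv sa)
      (ih sA (fun i => smooth_fderiv (sB i)) sa (smooth_fderiv sb) hA.pred hB.2) hA.2

lemma Cv.param {k : ℕ} {P : Type} [NormedAddCommGroup P] [NormedSpace ℝ P]
    {e : ι → P} {e0 : P} (he : Tendsto e l (𝓝 e0)) :
    ∀ {G : Type} [NormedAddCommGroup G] [NormedSpace ℝ G]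
    {A : P × E → G}, ContDiff ℝ ∞ A → Cv l k (fun i x => A (e i, x)) (fun x => A (e0, x)) := by
  have h0 : ∀ {G : Type} [NormedAddCommGroup G] [NormedSpace ℝ G]
    {A : P × E → G}, ContDiff ℝ ∞ A → Cv0 l (fun i x => A (e i, x)) (fun x => A (e0, x)) := by
    intro G _ _ A hA x
    exact (hA.continuous.tendsto (e0, x)).comp ((he.comp tendsto_fst).prodMk_nhds tendsto_snd)
  induction k with
  | zero => exact h0
  | succ k ih =>
    intro G _ _ A hA
    refine ⟨h0 hA, ?_⟩
    have e1 : ∀ p : P, fderiv ℝ (fun x => A (p, x)) =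
        fun x => (fderiv ℝ A (p, x)) ∘L (ContinuousLinearMap.inr ℝ P E) := by
      intro p; funext x
      exact ((smooth_diff hA (p, x)).hasFDerivAt.comp x (hasFDerivAt_prodMk_right p x)).fderiv
    simp only [e1]
    exact ih (A := fun z => (fderiv ℝ A z) ∘L (ContinuousLinearMap.inr ℝ P E))
      ((smooth_fderiv hA).clm_comp contDiff_const)

lemma Cv0.eventually_compact {F : ι → E → G} {f : E → G} (hf : Continuous f) (h : Cv0 l F f)
    {K : Set E} (hK : IsCompact K) {ε : ℝ} (hε : 0 < ε) :
    ∀ᶠ i in l, ∀ x ∈ K, ‖F i x - f x‖ < ε := by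
  have h1 : ∀ x ∈ K, ∀ᶠ z : ι × E in l ×ˢ 𝓝 x, ‖F z.1 z.2 - f z.2‖ < ε := by
    intro x _
    have h2 : Tendsto (fun z : ι × E => ‖F z.1 z.2 - f z.2‖) (l ×ˢ 𝓝 x) (𝓝 ‖f x - f x‖) :=
      ((h x).sub ((hf.tendsto x).comp tendsto_snd)).norm
    rw [sub_self, norm_zero] at h2
    exact h2.eventually (gt_mem_nhds hε)
  have h2 := hK.mem_prod_nhdsSet_of_forall h1
  obtain ⟨S, hS, T, hT, hST⟩ := mem_prod_iff.1 h2
  filter_upwards [hS] with i hi x hx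
  exact hST (mk_mem_prod hi (subset_of_mem_nhdsSet hT hx))

lemma Cv.eventually_close {k : ℕ} {K : Set E} (hK : IsCompact K) {ε : ℝ} (hε : 0 < ε) :
    ∀ {G : Type} [NormedAddCommGroup G] [NormedSpace ℝ G] {F : ι → E → G} {f : E → G},
    (∀ i, ContDiff ℝ ∞ (F i)) → ContDiff ℝ ∞ f → Cv l k F f →
    ∀ᶠ i in l, ∀ j ≤ k, ∀ x ∈ K, ‖iteratedFDeriv ℝ j (fun y => F i y - f y) x‖ < ε := by
  induction k with
  | zero =>
    intro G _ _ F f sF sf h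
    filter_upwards [Cv0.eventually_compact sf.continuous h hK hε] with i hi j hj x hx
    obtain rfl : j = 0 := by omega
    rw [norm_iteratedFDeriv_zero]; exact hi x hx
  | succ k ih =>
    intro G _ _ F f sF sf h
    filter_upwards [Cv0.eventually_compact sf.continuous h.1 hK hε,
      ih (fun i => smooth_fderiv (sF i)) (smooth_fderiv sf) h.2] with i hi hi2 j hj x hx
    cases j with
    | zero => rw [norm_iteratedFDeriv_zero]; exact hi x hx
    | succ j =>
      rw [← norm_iteratedFDeriv_fderiv]
      have e : fderiv ℝ (fun y => F i y - f y) = fun y => fderiv ℝ (F i) y - fderiv ℝ f y := by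
        funext y
        exact fderiv_fun_sub (smooth_diff (sF i) y) (smooth_diff sf y)
      rw [e]
      exact hi2 j (by omega) x hx

lemma Cv.of_close [ProperSpace E] {k : ℕ} :
    ∀ {G : Type} [NormedAddCommGroup G] [NormedSpace ℝ G] {F : ι → E → G} {f : E → G},
    (∀ i, ContDiff ℝ ∞ (F i)) → ContDiff ℝ ∞ f →
    (∀ K : Set E, IsCompact K → ∀ ε > 0, ∀ j ≤ k,
      ∀ᶠ i in l, ∀ x ∈ K, ‖iteratedFDeriv ℝ j (fun y => F i y - f y) x‖ < ε) → Cv l k F f := by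
  have h0 : ∀ {G : Type} [NormedAddCommGroup G] [NormedSpace ℝ G] {F : ι → E → G} {f : E → G},
    (∀ i, ContDiff ℝ ∞ (F i)) → ContDiff ℝ ∞ f →
    (∀ K : Set E, IsCompact K → ∀ ε > 0, 
      ∀ᶠ i in l, ∀ x ∈ K, ‖iteratedFDeriv ℝ 0 (fun y => F i y - f y) x‖ < ε) → Cv0 l F f := by
    intro G _ _ F f sF sf h x
    have h1 : Tendsto (fun z : ι × E => F z.1 z.2 - f z.2) (l ×ˢ 𝓝 x) (𝓝 0) := by
      rw [Metric.tendsto_nhds]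
      intro ε hε
      have h2 := h (Metric.closedBall x 1) (isCompact_closedBall x 1) ε hε
      filter_upwards [h2.prod_mk (Metric.closedBall_mem_nhds x one_pos)] with z hz
      have := hz.1 z.2 hz.2
      rw [norm_iteratedFDeriv_zero] at this
      simpa using this
    have h2 := h1.add ((sf.continuous.tendsto x).comp tendsto_snd)
    simpa using h2
  induction k with
  | zero => 
    intro G _ _ F f sF sf h
    exact h0 sF sf fun K hK ε hε => h K hK ε hε 0 le_rfl
  | succ k ih =>
    intro G _ _ F f sF sf h
    refine ⟨h0 sF sf fun K hK ε hε => h K hK ε hε 0 (by omega), ?_⟩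
    refine ih (fun i => smooth_fderiv (sF i)) (smooth_fderiv sf) fun K hK ε hε j hj => ?_
    filter_upwards [h K hK ε hε (j + 1) (by omega)] with i hi x hx
    have := hi x hx
    rw [← norm_iteratedFDeriv_fderiv] at this
    have e : fderiv ℝ (fun y => F i y - f y) = fun y => fderiv ℝ (F i) y - fderiv ℝ f y := by
      funext y
      exact fderiv_fun_sub (smooth_diff (sF i) y) (smooth_diff sf y)
    rwa [e] at this

end CvPart
end TorusCtl

open MeasureTheory Real
set_option linter.unusedSectionVars false
namespace TorusCtl
noncomputable section ARPart
open Set Filter Topology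
open scoped ContDiff

variable {d : ℕ} {U : Type} {Ham : U → Phase d → ℝ}

lemma foldl_comp_aux {α : Type} (L : List (α → α)) (g : α → α) :
    L.foldl (fun g f => f ∘ g) g = (L.foldl (fun g f => f ∘ g) id) ∘ g := by
  induction L generalizing g with
  | nil => rfl
  | cons a L ih =>
    simp only [List.foldl_cons]
    rw [ih (a ∘ g), ih (a ∘ id)]
    rfl

lemma reachable_comp {τ₁ τ₂ : ℝ} {A B : Phase d → Phase d} (hA : Reachable Ham τ₁ A)
    (hB : Reachable Ham τ₂ B) : Reachable Ham (τ₁ + τ₂) (B ∘ A) := by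
  obtain ⟨n, du, u, φ, h0, hs, hf, rfl⟩ := hA
  obtain ⟨m, dv, v, ψ, h0', hs', hf', rfl⟩ := hB
  refine ⟨n + m, Fin.append du dv, Fin.append u v, Fin.append φ ψ, ?_, ?_, ?_, ?_⟩
  · intro i
    refine Fin.addCases (fun i => ?_) (fun i => ?_) i <;> simp [h0, h0']
  · rw [Fin.sum_univ_add]; simp [hs, hs']
  · intro i
    refine Fin.addCases (fun i => ?_) (fun i => ?_) i <;> simp [hf, hf']
  · have : (fun i => (Fin.append φ ψ) i ((Fin.append du dv) i)) =
        Fin.append (fun i => φ i (du i)) (fun i => ψ i (dv i)) := by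
      funext i
      refine Fin.addCases (fun i => ?_) (fun i => ?_) i <;> simp
    rw [this, List.ofFn_fin_append, List.foldl_append]
    exact (foldl_comp_aux _ _).symm

/-- `Ψ` is a limit of maps reachable in times tending to `τ`. -/
def AR (Ham : U → Phase d → ℝ) (τ : ℝ) (Ψ : Phase d → Phase d) : Prop :=
  ContDiff ℝ ∞ Ψ ∧ ∃ (t : ℕ → ℝ) (Φ : ℕ → Phase d → Phase d),
    (∀ n, 0 ≤ t n) ∧ Tendsto t atTop (𝓝 τ) ∧ (∀ n, Reachable Ham (t n) (Φ n)) ∧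
    (∀ n, ContDiff ℝ ∞ (Φ n)) ∧ ∀ k, Cv atTop k Φ Ψ

lemma AR.of_reachable {τ : ℝ} {Ψ : Phase d → Phase d} (h0 : 0 ≤ τ) (h : Reachable Ham τ Ψ)
    (s : ContDiff ℝ ∞ Ψ) : AR Ham τ Ψ :=
  ⟨s, fun _ => τ, fun _ => Ψ, fun _ => h0, tendsto_const_nhds, fun _ => h, fun _ => s,
    fun _ => Cv.const s⟩

lemma AR.comp {τ₁ τ₂ : ℝ} {A B : Phase d → Phase d} (hA : AR Ham τ₁ A) (hB : AR Ham τ₂ B) :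
    AR Ham (τ₁ + τ₂) (B ∘ A) := by
  obtain ⟨sA, t, Φ, t0, tt, hr, hs, hc⟩ := hA
  obtain ⟨sB, t', Φ', t0', tt', hr', hs', hc'⟩ := hB
  exact ⟨sB.comp sA, fun n => t n + t' n, fun n => Φ' n ∘ Φ n, fun n => add_nonneg (t0 n) (t0' n),
    tt.add tt', fun n => reachable_comp (hr n) (hr' n), fun n => (hs' n).comp (hs n),
    fun k => Cv.comp (A := Φ) (B := Φ') (a := A) (b := B) hs hs' sA sB (hc k) (hc' k)⟩

lemma AR.eps {τ : ℝ} {Ψ : Phase d → Phase d} (h : AR Ham τ Ψ) {ε : ℝ} (hε : 0 < ε)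
    {K : Set (Phase d)} (hK : IsCompact K) (l : ℕ) :
    ∃ t, 0 ≤ t ∧ |t - τ| < ε ∧ ∃ Φ, Reachable Ham t Φ ∧ ContDiff ℝ ∞ Φ ∧ CloseCl l K ε Φ Ψ := by
  obtain ⟨sA, t, Φ, t0, tt, hr, hs, hc⟩ := h
  have h1 := Cv.eventually_close hK hε hs sA (hc l)
  have h2 := Metric.tendsto_nhds.1 tt ε hε
  obtain ⟨n, h1, h2⟩ := (h1.and h2).exists
  exact ⟨t n, t0 n, h2, Φ n, hr n, hs n, h1⟩

lemma AR.small {Ψ : Phase d → Phase d} (h : AR Ham 0 Ψ) : SmallTimeReachable Ham Ψ := by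
  intro ε hε K hK l
  obtain ⟨t, t0, t1, Φ, hr, -, hc⟩ := h.eps hε hK l
  refine ⟨t, ⟨t0, ?_⟩, Φ, hr, hc⟩
  rw [sub_zero, abs_of_nonneg t0] at t1
  exact t1.le

lemma AR.closed {τ : ℕ → ℝ} {τ0 : ℝ} {Ψ : ℕ → Phase d → Phase d} {Ψ0 : Phase d → Phase d}
    (hτ : Tendsto τ atTop (𝓝 τ0)) (h : ∀ n, AR Ham (τ n) (Ψ n)) (s0 : ContDiff ℝ ∞ Ψ0)
    (hc : ∀ k, Cv atTop k Ψ Ψ0) : AR Ham τ0 Ψ0 := by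
  have pos : ∀ n : ℕ, (0:ℝ) < 1 / (n + 1) := fun n => by positivity
  choose t t0 t1 Φ hr hs hcl using fun n : ℕ =>
    (h n).eps (pos n) (isCompact_closedBall (0 : Phase d) n) n
  have hsm : ∀ n, ContDiff ℝ ∞ (Ψ n) := fun n => (h n).1
  refine ⟨s0, t, Φ, t0, ?_, hr, hs, fun k => ?_⟩
  · have : Tendsto (fun n => t n - τ n) atTop (𝓝 0) :=
      squeeze_zero_norm (fun n => (t1 n).le) tendsto_one_div_add_atTop_nhds_zero_nat
    simpa using this.add hτ
  · have hd : Cv atTop k (fun n x => Φ n x - Ψ n x) (fun _ => 0) := by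
      refine Cv.of_close (fun n => (hs n).sub (hsm n)) contDiff_const ?_
      intro K hK ε hε j hj
      obtain ⟨R, hR⟩ := hK.isBounded.subset_closedBall 0
      have e1 : ∀ᶠ n : ℕ in atTop, 1 / ((n:ℝ) + 1) < ε :=
        tendsto_one_div_add_atTop_nhds_zero_nat.eventually (gt_mem_nhds hε)
      filter_upwards [e1, eventually_ge_atTop j, eventually_ge_atTop ⌈R⌉₊] with n h1 h2 h3 x hx
      have := hcl n j h2 x (Metric.closedBall_subset_closedBall (Nat.ceil_le.1 h3) (hR hx))
      simp only [sub_zero]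
      exact this.trans h1
    have := Cv.add (fun n => (hs n).sub (hsm n)) hsm contDiff_const s0 hd (hc k)
    simpa using this

end ARPart
end TorusCtl

open MeasureTheory Real
set_option linter.unusedSectionVars false
namespace TorusCtl
noncomputable section MechPart
open Set Filter Topology
open scoped ContDiff NNReal

lemma global_curve {E : Type} [NormedAddCommGroup E] [NormedSpace ℝ E] [CompleteSpace E]
    {X : E → E} (hX : ContDiff ℝ ∞ X) {K : ℝ≥0} (hK : LipschitzWith K X) (x : E) :
    ∃ γ : ℝ → E, γ 0 = x ∧ ∀ t, HasDerivAt γ (X (γ t)) t := by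
  have hε : (0:ℝ) < 1 / (K + 1) := by positivity
  set ε : ℝ := 1 / (K + 1) with hεd
  have hv : ContMDiff (modelWithCornersSelf ℝ E) (modelWithCornersSelf ℝ E).tangent 1
      (fun x ↦ (⟨x, X x⟩ : TangentBundle (modelWithCornersSelf ℝ E) E)) :=
    contMDiff_vectorSpace_iff_contDiff.2 (hX.of_le (by exact_mod_cast le_top))
  obtain ⟨γ, h0, h1⟩ := exists_isMIntegralCurve_of_isMIntegralCurveOn
    (I := modelWithCornersSelf ℝ E) (M := E) (v := X) hv hε (fun x0 => by
      have h0 : (0:ℝ) ∈ Icc (-ε) ε := ⟨by linarith, hε.le⟩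
      have hp : IsPicardLindelof (fun _ => X) (⟨0, h0⟩ : Icc (-ε) ε) x0 (‖X x0‖₊ + 1) 0
          (‖X x0‖₊ + K * (‖X x0‖₊ + 1)) K := by
        refine IsPicardLindelof.of_time_independent ?_ (hK.lipschitzOnWith) ?_
        · intro y hy
          have h1 := hK.dist_le_mul y x0
          rw [Metric.mem_closedBall] at hy
          rw [dist_eq_norm] at h1
          have h2 : ‖X y‖ ≤ ‖X x0‖ + ‖X y - X x0‖ := by
            have := norm_add_le (X x0) (X y - X x0); simpa using this
          have h3 : (K:ℝ) * dist y x0 ≤ K * (‖X x0‖ + 1) := by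
            refine mul_le_mul_of_nonneg_left ?_ K.2
            simpa using hy
          push_cast
          linarith
        · simp only [sub_zero, zero_sub, neg_neg, max_self]
          push_cast
          simp only [hεd]
          rw [mul_one_div, div_le_iff₀ (by positivity)]
          nlinarith [norm_nonneg (X x0), K.2]
      obtain ⟨α, ha, hb⟩ := hp.exists_eq_forall_mem_Icc_hasDerivWithinAt₀
      refine ⟨α, ha, fun t ht => ?_⟩
      exact ((hb t (Ioo_subset_Icc_self ht)).mono Ioo_subset_Icc_self).hasFDerivWithinAt.hasMFDerivWithinAt) x
  refine ⟨γ, h0, fun t => ?_⟩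
  have h2 : HasFDerivAt γ ((1 : ℝ →L[ℝ] ℝ).smulRight (X (γ t))) t :=
    hasMFDerivAt_iff_hasFDerivAt.1 (h1 t)
  simpa using h2.hasDerivAt

variable {d : ℕ}

/-- Smooth and `2π`-periodic functions. -/
def PerSm (f : (Fin d → ℝ) → ℝ) : Prop :=
  ContDiff ℝ ∞ f ∧ ∀ (q : Fin d → ℝ) (k : Fin d → ℤ),
    f (fun i => q i + 2 * Real.pi * (k i)) = f q

/-- The gradient. -/
def gr (f : (Fin d → ℝ) → ℝ) (q : Fin d → ℝ) : Fin d → ℝ :=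
  fun i => fderiv ℝ f q (Pi.single i 1)

lemma gr_smooth {f : (Fin d → ℝ) → ℝ} (hf : ContDiff ℝ ∞ f) : ContDiff ℝ ∞ (gr f) :=
  contDiff_pi.2 fun _ => (smooth_fderiv hf).clm_apply contDiff_const

lemma gr_add {f g : (Fin d → ℝ) → ℝ} (hf : ContDiff ℝ ∞ f) (hg : ContDiff ℝ ∞ g)
    (q : Fin d → ℝ) : gr (fun q => f q + g q) q = gr f q + gr g q := by
  funext i
  simp only [gr, Pi.add_apply]
  rw [fderiv_fun_add (smooth_diff hf q) (smooth_diff hg q)]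
  rfl

lemma gr_smul {f : (Fin d → ℝ) → ℝ} (hf : ContDiff ℝ ∞ f) (c : ℝ)
    (q : Fin d → ℝ) : gr (fun q => c * f q) q = c • gr f q := by
  funext i
  simp only [gr, Pi.smul_apply]
  rw [fderiv_const_mul (smooth_diff hf q)]
  rfl

lemma vshear_eq (f : (Fin d → ℝ) → ℝ) (x : Phase d) : vshear f x = (x.1, x.2 - gr f x.1) := rfl

lemma vshear_smooth {f : (Fin d → ℝ) → ℝ} (hf : ContDiff ℝ ∞ f) : ContDiff ℝ ∞ (vshear f) :=
  contDiff_fst.prodMk (contDiff_snd.sub ((gr_smooth hf).comp contDiff_fst))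

lemma periodic_bounded {G : Type} [NormedAddCommGroup G] {F : (Fin d → ℝ) → G}
    (hF : Continuous F)
    (hp : ∀ (q : Fin d → ℝ) (k : Fin d → ℤ), F (fun i => q i + 2 * Real.pi * (k i)) = F q) :
    ∃ C : ℝ≥0, ∀ q, ‖F q‖₊ ≤ C := by
  have hc : IsCompact (Set.pi univ fun _ : Fin d => Icc (0:ℝ) (2 * Real.pi)) :=
    isCompact_univ_pi fun _ => isCompact_Icc
  obtain ⟨C, hC⟩ := hc.exists_bound_of_continuousOn hF.continuousOn
  refine ⟨C.toNNReal, fun q => ?_⟩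
  have hpi : (0:ℝ) < 2 * Real.pi := by positivity
  have h1 := hC (fun i => q i + 2 * Real.pi * ((-⌊q i / (2 * Real.pi)⌋ : ℤ) : ℝ)) (by
    intro i _
    have h2 := Int.floor_le (q i / (2 * Real.pi))
    have h3 := (Int.lt_floor_add_one (q i / (2 * Real.pi))).le
    rw [le_div_iff₀ hpi] at h2
    rw [div_le_iff₀ hpi] at h3
    push_cast
    constructor <;> nlinarith)
  rw [hp q (fun i => -⌊q i / (2 * Real.pi)⌋)] at h1
  rw [← NNReal.coe_le_coe, coe_nnnorm]
  exact h1.trans (Real.le_coe_toNNReal C)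

lemma fderiv_periodic {G : Type} [NormedAddCommGroup G] [NormedSpace ℝ G] {F : (Fin d → ℝ) → G}
    (hp : ∀ (q : Fin d → ℝ) (k : Fin d → ℤ), F (fun i => q i + 2 * Real.pi * (k i)) = F q)
    (q : Fin d → ℝ) (k : Fin d → ℤ) :
    fderiv ℝ F (fun i => q i + 2 * Real.pi * (k i)) = fderiv ℝ F q := by
  have h1 : (fun x => F (x + fun i => 2 * Real.pi * (k i))) = F := by
    funext x; exact hp x k
  have h2 := fderiv_comp_add_right (𝕜 := ℝ) (f := F) (x := q) (fun i => 2 * Real.pi * (k i))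
  rw [h1] at h2
  exact h2.symm

/-- The mechanical vector field. -/
def mechVF (V : (Fin d → ℝ) → ℝ) (x : Phase d) : Phase d := (x.2, - gr V x.1)

lemma mechVF_smooth {V : (Fin d → ℝ) → ℝ} (hV : ContDiff ℝ ∞ V) : ContDiff ℝ ∞ (mechVF V) :=
  contDiff_snd.prodMk ((gr_smooth hV).comp contDiff_fst).neg

lemma flow_exists {V : (Fin d → ℝ) → ℝ} (hV : PerSm V) : ∃ φ, IsFlowOf (mechVF V) φ := by
  have hgp : ∀ (q : Fin d → ℝ) (k : Fin d → ℤ),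
      gr V (fun i => q i + 2 * Real.pi * (k i)) = gr V q := by
    intro q k
    funext i
    simp only [gr]
    rw [fderiv_periodic hV.2 q k]
  have hs := gr_smooth hV.1
  obtain ⟨C, hC⟩ := periodic_bounded (smooth_fderiv hs).continuous (fderiv_periodic hgp)
  have hL : LipschitzWith C (gr V) :=
    lipschitzWith_of_nnnorm_fderiv_le (smooth_diff hs) hC
  have hL2 : LipschitzWith (max 1 (C * 1)) (mechVF V) :=
    LipschitzWith.prodMk LipschitzWith.prod_snd (hL.comp LipschitzWith.prod_fst).neg
  choose γ h0 h1 using global_curve (mechVF_smooth hV.1) hL2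
  exact ⟨fun t x => γ x t, h0, h1⟩

lemma flow_smooth {X : Phase d → Phase d} (hX : ContDiff ℝ ∞ X) {φ : ℝ → Phase d → Phase d}
    (hφ : IsFlowOf X φ) (t : ℝ) : ContDiff ℝ ∞ (φ t) := by
  refine flow_contDiff (X := fun x => t • X x) (by fun_prop) fun x => ?_
  refine ⟨fun s => φ (t * s) x, by simp [hφ.1], by simp, fun s _ => ?_⟩
  have h1 := hφ.2 x (t * s)
  have h2 : HasDerivAt (fun s : ℝ => t * s) t s := by
    simpa using (hasDerivAt_id s).const_mul t
  exact (h1.scomp s h2).hasDerivWithinAt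

end MechPart
end TorusCtl

open MeasureTheory Real
set_option linter.unusedSectionVars false
namespace TorusCtl
noncomputable section KeyPart
open Set Filter Topology
open scoped ContDiff NNReal

variable {d : ℕ}

/-- `|∇g|²/2`. -/
def kin (g : (Fin d → ℝ) → ℝ) (q : Fin d → ℝ) : ℝ := (∑ j, gr g q j ^ 2) / 2

lemma kin_smooth {g : (Fin d → ℝ) → ℝ} (hg : ContDiff ℝ ∞ g) : ContDiff ℝ ∞ (kin g) := by
  have h : ∀ j, ContDiff ℝ ∞ (fun q => gr g q j) := fun j => contDiff_pi.1 (gr_smooth hg) j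
  exact (ContDiff.sum fun j _ => (h j).pow 2).div_const 2

lemma hess_apply {g : (Fin d → ℝ) → ℝ} (hg : ContDiff ℝ ∞ g) (q v : Fin d → ℝ) (i : Fin d) :
    fderiv ℝ (gr g) q v i = fderiv ℝ (fderiv ℝ g) q v (Pi.single i 1) := by
  have h1 := smooth_diff (smooth_fderiv hg) q
  have h2 : ∀ j, HasFDerivAt (fun q => gr g q j)
      ((ContinuousLinearMap.apply ℝ ℝ (Pi.single j 1 : Fin d → ℝ)).comp
        (fderiv ℝ (fderiv ℝ g) q)) q := fun j =>
    (ContinuousLinearMap.apply ℝ ℝ (Pi.single j 1 : Fin d → ℝ)).hasFDerivAt.comp q h1.hasFDerivAt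
  have h3 : HasFDerivAt (gr g) _ q := hasFDerivAt_pi.2 h2
  rw [h3.fderiv]
  rfl

lemma gr_kin {g : (Fin d → ℝ) → ℝ} (hg : ContDiff ℝ ∞ g) (q : Fin d → ℝ) :
    gr (kin g) q = fderiv ℝ (gr g) q (gr g q) := by
  funext i
  have hd : ∀ j, HasFDerivAt (fun q => gr g q j)
      ((ContinuousLinearMap.proj j).comp (fderiv ℝ (gr g) q)) q := fun j =>
    (ContinuousLinearMap.proj (R := ℝ) (φ := fun _ : Fin d => ℝ) j).hasFDerivAt.comp q
      (smooth_diff (gr_smooth hg) q).hasFDerivAt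
  have h1 : HasFDerivAt (kin g) _ q :=
    (HasFDerivAt.fun_sum (u := Finset.univ) fun j _ => (hd j).pow 2).mul_const (2:ℝ)⁻¹
  have hsym : ∀ v w, fderiv ℝ (fderiv ℝ g) q v w = fderiv ℝ (fderiv ℝ g) q w v := by
    have := (hg.contDiffAt (x := q)).isSymmSndFDerivAt (by
      simp only [minSmoothness_of_isRCLikeNormedField]
      exact WithTop.coe_le_coe.2 le_top)
    exact this
  rw [hess_apply hg, hsym]
  change fderiv ℝ (kin g) q (Pi.single i 1) = _
  rw [h1.fderiv]
  have h5 := LinearMap.pi_apply_eq_sum_univ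
    (fderiv ℝ (fderiv ℝ g) q (Pi.single i 1)).toLinearMap (gr g q)
  rw [ContinuousLinearMap.coe_coe] at h5
  rw [h5]
  simp only [smul_apply, sum_apply,
    ContinuousLinearMap.comp_apply, ContinuousLinearMap.proj_apply, hess_apply hg, smul_eq_mul]
  rw [Finset.mul_sum]
  refine Finset.sum_congr rfl fun j _ => ?_
  have h6 : (fun k : Fin d => if j = k then (1:ℝ) else 0) = Pi.single j 1 := by
    funext k
    simp [Pi.single_apply, eq_comm]
  rw [h6]
  simp
  ring

/-- The conjugated and rescaled vector field. -/
def YF (V0 W g : (Fin d → ℝ) → ℝ) (z : ℝ × Phase d) : ℝ × Phase d :=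
  (0, (z.1 ^ 2 • z.2.2 + z.1 • gr g z.2.1,
    -(z.1 ^ 2 • gr V0 z.2.1) - gr W z.2.1 - fderiv ℝ (gr g) z.2.1 (z.1 • z.2.2 + gr g z.2.1)))

lemma YF_smooth {V0 W g : (Fin d → ℝ) → ℝ} (hV : ContDiff ℝ ∞ V0) (hW : ContDiff ℝ ∞ W)
    (hg : ContDiff ℝ ∞ g) : ContDiff ℝ ∞ (YF V0 W g) := by
  have h1 := gr_smooth hV
  have h2 := gr_smooth hW
  have h3 := gr_smooth hg
  have h4 := smooth_fderiv h3
  unfold YF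
  have e1 : ContDiff ℝ ∞ (fun z : ℝ × Phase d => gr V0 z.2.1) := h1.comp (by fun_prop)
  have e2 : ContDiff ℝ ∞ (fun z : ℝ × Phase d => gr W z.2.1) := h2.comp (by fun_prop)
  have e3 : ContDiff ℝ ∞ (fun z : ℝ × Phase d => gr g z.2.1) := h3.comp (by fun_prop)
  have e4 : ContDiff ℝ ∞ (fun z : ℝ × Phase d => fderiv ℝ (gr g) z.2.1) := h4.comp (by fun_prop)
  fun_prop

lemma YF_zero {V0 W g : (Fin d → ℝ) → ℝ} (hW : ContDiff ℝ ∞ W)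
    (hg : ContDiff ℝ ∞ g) (x : Phase d) :
    Sol (YF V0 W g) (0, x) (0, vshear (fun q => W q + kin g q) x) := by
  refine ⟨fun t => (0, (x.1, x.2 - t • gr (fun q => W q + kin g q) x.1)), by simp,
    by simp [vshear_eq], fun t _ => ?_⟩
  have h1 : HasDerivAt (fun t : ℝ => x.2 - t • gr (fun q => W q + kin g q) x.1)
      (- gr (fun q => W q + kin g q) x.1) t := by
    simpa using ((hasDerivAt_id t).smul_const (gr (fun q => W q + kin g q) x.1)).const_sub x.2
  have h2 := (hasDerivAt_const t (0:ℝ)).prodMk ((hasDerivAt_const t x.1).prodMk h1)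
  refine (h2.congr_deriv ?_).hasDerivWithinAt
  simp only [YF]
  rw [gr_add hW (kin_smooth hg), gr_kin hg]
  simp
  abel

lemma YF_ne {V0 W g : (Fin d → ℝ) → ℝ} (hV : ContDiff ℝ ∞ V0) (hW : ContDiff ℝ ∞ W)
    (hg : ContDiff ℝ ∞ g) {ε : ℝ} (hε : ε ≠ 0) {ψ : ℝ → Phase d → Phase d}
    (hψ : IsFlowOf (mechVF (fun q => V0 q + (ε ^ 2)⁻¹ * W q)) ψ) (x : Phase d) :
    Sol (YF V0 W g) (ε, x) (ε, vshear (fun q => ε⁻¹ * g q)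
      (ψ (ε ^ 2) (vshear (fun q => -ε⁻¹ * g q) x))) := by
  set y := vshear (fun q => -ε⁻¹ * g q) x with hy
  refine ⟨fun s => (ε, vshear (fun q => ε⁻¹ * g q) (ψ (ε ^ 2 * s) y)), ?_, by simp, fun s _ => ?_⟩
  · simp only [mul_zero, hψ.1, hy, vshear_eq, gr_smul hg]
    simp
  have h2 : HasDerivAt (fun s : ℝ => ε ^ 2 * s) (ε ^ 2) s := by
    simpa using (hasDerivAt_id s).const_mul (ε ^ 2)
  have h1 := (hψ.2 y (ε ^ 2 * s)).scomp s h2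
  have hq : HasDerivAt (fun s => (ψ (ε ^ 2 * s) y).1) _ s :=
    (ContinuousLinearMap.fst ℝ (Fin d → ℝ) (Fin d → ℝ)).hasFDerivAt.comp_hasDerivAt s h1
  have hp : HasDerivAt (fun s => (ψ (ε ^ 2 * s) y).2) _ s :=
    (ContinuousLinearMap.snd ℝ (Fin d → ℝ) (Fin d → ℝ)).hasFDerivAt.comp_hasDerivAt s h1
  have hgq : HasDerivAt (fun s => gr g (ψ (ε ^ 2 * s) y).1) _ s :=
    (smooth_diff (gr_smooth hg) _).hasFDerivAt.comp_hasDerivAt s hq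
  have h3 := (hasDerivAt_const s ε).prodMk (hq.prodMk (hp.sub (hgq.const_smul ε⁻¹)))
  have e : (fun s => (ε, vshear (fun q => ε⁻¹ * g q) (ψ (ε ^ 2 * s) y))) =
      fun s => (ε, ((ψ (ε ^ 2 * s) y).1, (ψ (ε ^ 2 * s) y).2 - ε⁻¹ • gr g (ψ (ε ^ 2 * s) y).1)) := by
    funext s
    rw [vshear_eq, gr_smul hg]
  rw [e]
  refine HasDerivAt.hasDerivWithinAt (h3.congr_deriv ?_)
  set Q := (ψ (ε ^ 2 * s) y).1
  set P := (ψ (ε ^ 2 * s) y).2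
  simp only [YF, mechVF, ContinuousLinearMap.coe_fst', ContinuousLinearMap.coe_snd']
  rw [gr_add hV (contDiff_const.mul hW), gr_smul hW]
  refine Prod.ext rfl (Prod.ext ?_ ?_)
  · simp only [Prod.smul_fst]
    funext i
    simp
    field_simp
    ring
  · simp only [Prod.smul_snd, Prod.smul_fst]
    have h5 : ε • (P - ε⁻¹ • gr g Q) + gr g Q = ε • P := by
      rw [smul_sub, smul_smul, mul_inv_cancel₀ hε, one_smul, sub_add_cancel]
    rw [h5, map_smul, map_smul]
    funext i
    simp
    field_simp
    ring

lemma limit_shear {V0 W g : (Fin d → ℝ) → ℝ} (hV : ContDiff ℝ ∞ V0) (hW : ContDiff ℝ ∞ W)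
    (hg : ContDiff ℝ ∞ g) {ψ : ℝ → ℝ → Phase d → Phase d}
    (hψ : ∀ ε : ℝ, ε ≠ 0 → IsFlowOf (mechVF (fun q => V0 q + (ε ^ 2)⁻¹ * W q)) (ψ ε))
    {e : ℕ → ℝ} (he : ∀ n, e n ≠ 0) (he0 : Tendsto e atTop (𝓝 0)) (k : ℕ) :
    Cv atTop k (fun n => vshear (fun q => (e n)⁻¹ * g q) ∘ (ψ (e n) ((e n) ^ 2) ∘
      vshear (fun q => -(e n)⁻¹ * g q))) (vshear (fun q => W q + kin g q)) := by
  classical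
  let G : ℝ × Phase d → ℝ × Phase d := fun z => (z.1, if z.1 = 0 then
    vshear (fun q => W q + kin g q) z.2 else (vshear (fun q => z.1⁻¹ * g q)
      (ψ z.1 (z.1 ^ 2) (vshear (fun q => -z.1⁻¹ * g q) z.2))))
  have hG : ContDiff ℝ ∞ G := by
    refine flow_contDiff (YF_smooth hV hW hg) ?_
    rintro ⟨ε, x⟩
    by_cases h : ε = 0
    · subst h
      simp only [G, if_true]
      exact YF_zero hW hg x
    · simp only [G, if_neg h]
      exact YF_ne hV hW hg h (hψ ε h) x
  have h1 := Cv.param (k := k) he0 (A := fun z => (G z).2) hG.snd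
  have h2 : (fun n x => (G (e n, x)).2) = (fun n => vshear (fun q => (e n)⁻¹ * g q) ∘
      (ψ (e n) ((e n) ^ 2) ∘ vshear (fun q => -(e n)⁻¹ * g q))) := by
    funext n x
    simp only [G, if_neg (he n)]
    rfl
  have h3 : (fun x => (G (0, x)).2) = vshear (fun q => W q + kin g q) := by
    funext x
    simp only [G, if_true]
  rw [h2, h3] at h1
  exact h1

/-- The controlled potential. -/
def Wp (u : Fin d → ℝ × ℝ) (q : Fin d → ℝ) : ℝ :=
  ∑ j, ((u j).1 * Real.cos (∑ i, kvec d j i * q i) + (u j).2 * Real.sin (∑ i, kvec d j i * q i))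

lemma Wp_smooth (u : Fin d → ℝ × ℝ) : ContDiff ℝ ∞ (Wp u) := by
  unfold Wp
  have : ∀ j, ContDiff ℝ ∞ (fun q : Fin d → ℝ => ∑ i, kvec d j i * q i) := fun j => by fun_prop
  refine ContDiff.sum fun j _ => ?_
  exact (contDiff_const.mul (Real.contDiff_cos.comp (this j))).add
    (contDiff_const.mul (Real.contDiff_sin.comp (this j)))

lemma kvec_int (j : Fin d) : ∃ n : Fin d → ℤ, ∀ i, kvec d j i = n i := by
  classical
  unfold kvec
  split_ifs
  · refine ⟨Pi.single j 1, fun i => ?_⟩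
    by_cases h : i = j
    · subst h; simp
    · simp [h]
  · exact ⟨fun _ => 1, fun i => by simp⟩

lemma Wp_per (u : Fin d → ℝ × ℝ) : PerSm (Wp u) := by
  refine ⟨Wp_smooth u, fun q k => ?_⟩
  unfold Wp
  refine Finset.sum_congr rfl fun j _ => ?_
  obtain ⟨n, hn⟩ := kvec_int j
  have : (∑ i, kvec d j i * (q i + 2 * Real.pi * (k i))) =
      (∑ i, kvec d j i * q i) + ((∑ i, n i * k i : ℤ) : ℝ) * (2 * Real.pi) := by
    push_cast
    rw [Finset.sum_mul, ← Finset.sum_add_distrib]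
    refine Finset.sum_congr rfl fun i _ => ?_
    rw [hn]; ring
  rw [this, Real.cos_add_int_mul_two_pi, Real.sin_add_int_mul_two_pi]

lemma Wp_smul (c : ℝ) (u : Fin d → ℝ × ℝ) (q : Fin d → ℝ) :
    Wp (fun j => c • u j) q = c * Wp u q := by
  unfold Wp
  rw [Finset.mul_sum]
  refine Finset.sum_congr rfl fun j _ => ?_
  simp only [Prod.smul_fst, Prod.smul_snd, smul_eq_mul]
  ring

lemma hamVF_mech {V : (Fin d → ℝ) → ℝ} (hV : ContDiff ℝ ∞ V) :
    hamVF (fun x : Phase d => (∑ i, (x.2 i) ^ 2) / 2 + V x.1) = mechVF V := by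
  funext x
  have hd : ∀ i, HasFDerivAt (fun x : Phase d => x.2 i)
      ((ContinuousLinearMap.proj (R := ℝ) (φ := fun _ : Fin d => ℝ) i).comp
        (ContinuousLinearMap.snd ℝ (Fin d → ℝ) (Fin d → ℝ))) x := fun i =>
    ((ContinuousLinearMap.proj (R := ℝ) (φ := fun _ : Fin d => ℝ) i).comp
        (ContinuousLinearMap.snd ℝ (Fin d → ℝ) (Fin d → ℝ))).hasFDerivAt
  have h1 : HasFDerivAt (fun x : Phase d => (∑ i, (x.2 i) ^ 2) / 2) _ x :=
    (HasFDerivAt.fun_sum (u := Finset.univ) fun j _ => (hd j).pow 2).mul_const (2:ℝ)⁻¹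
  have h2 : HasFDerivAt (fun x : Phase d => V x.1) ((fderiv ℝ V x.1).comp
      (ContinuousLinearMap.fst ℝ (Fin d → ℝ) (Fin d → ℝ))) x :=
    (smooth_diff hV x.1).hasFDerivAt.comp x
      (ContinuousLinearMap.fst ℝ (Fin d → ℝ) (Fin d → ℝ)).hasFDerivAt
  have h3 := (h1.add h2).fderiv
  have h4 : fderiv ℝ (fun x : Phase d => (∑ i, (x.2 i) ^ 2) / 2 + V x.1) x = _ := h3
  unfold hamVF
  rw [h4]
  refine Prod.ext ?_ ?_
  · funext i
    simp [mechVF, Pi.single_apply]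
  · funext i
    simp [mechVF, gr]

lemma hamVF_torus {V0 : (Fin d → ℝ) → ℝ} (hV : ContDiff ℝ ∞ V0) (u : Fin d → ℝ × ℝ) :
    hamVF (torusHam V0 u) = mechVF (fun q => V0 q + Wp u q) := by
  rw [← hamVF_mech (hV.add (Wp_smooth u))]
  congr 1
  funext x
  simp only [torusHam, Wp]
  ring

lemma reachable_flow {U : Type} {Ham : U → Phase d → ℝ} {u : U} {φ : ℝ → Phase d → Phase d}
    (h : IsFlowOf (hamVF (Ham u)) φ) {t : ℝ} (ht : 0 ≤ t) : Reachable Ham t (φ t) :=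
  ⟨1, fun _ => t, fun _ => u, fun _ => φ, fun _ => ht, by simp, fun _ => h, by simp⟩

theorem AR_key {V0 : (Fin d → ℝ) → ℝ} (hV : PerSm V0) {g : (Fin d → ℝ) → ℝ}
    (hg : ContDiff ℝ ∞ g) (h : ∀ c : ℝ, AR (torusHam V0) 0 (vshear (fun q => c * g q)))
    (u : Fin d → ℝ × ℝ) :
    AR (torusHam V0) 0 (vshear (fun q => Wp u q + kin g q)) := by
  have hfl : ∀ ε : ℝ, ∃ φ, IsFlowOf (mechVF (fun q => V0 q + (ε ^ 2)⁻¹ * Wp u q)) φ := by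
    intro ε
    refine flow_exists ⟨hV.1.add (contDiff_const.mul (Wp_smooth u)), fun q k => ?_⟩
    simp only []
    rw [hV.2, (Wp_per u).2]
  choose ψ hψ using hfl
  let e : ℕ → ℝ := fun n => 1 / ((n:ℝ) + 1)
  have hpos : ∀ n, 0 < e n := fun n => by positivity
  have he0 : Tendsto e atTop (𝓝 0) := tendsto_one_div_add_atTop_nhds_zero_nat
  have hlim := limit_shear hV.1 (Wp_smooth u) hg (fun ε _ => hψ ε) (fun n => (hpos n).ne') he0
  have h2 : ∀ n, AR (torusHam V0) (0 + (e n) ^ 2 + 0)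
      (vshear (fun q => (e n)⁻¹ * g q) ∘ (ψ (e n) ((e n) ^ 2) ∘
      vshear (fun q => -(e n)⁻¹ * g q))) := by
    intro n
    refine ((h _).comp (AR.of_reachable (sq_nonneg _) ?_ ?_)).comp (h _)
    · refine reachable_flow (u := fun j => ((e n) ^ 2)⁻¹ • u j) ?_ (sq_nonneg _)
      rw [hamVF_torus hV.1]
      simp only [Wp_smul]
      exact hψ (e n)
    · exact flow_smooth (mechVF_smooth (hV.1.add (contDiff_const.mul (Wp_smooth u)))) (hψ (e n)) _
  refine AR.closed ?_ h2 (vshear_smooth ((Wp_smooth u).add (kin_smooth hg))) hlim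
  simpa using (he0.pow 2)

end KeyPart
end TorusCtl

open MeasureTheory Real
set_option linter.unusedSectionVars false
namespace TorusCtl
noncomputable section AlgPart
open Set Filter Topology
open scoped ContDiff NNReal

lemma freq_all {d : ℕ} (T : (Fin d → ℤ) → Prop) (h0 : T 0) (hneg : ∀ k, T k → T (-k))
    (hadd : ∀ k l, T k → T l → (∑ i, k i * l i) ≠ 0 → T (k + l))
    (hb : ∀ j : Fin d, (j : ℕ) < d - 1 → T (Pi.single j 1)) (h1 : 0 < d → T (fun _ => 1)) :
    ∀ k, T k := by
  classical
  rcases Nat.eq_zero_or_pos d with hd | hd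
  · subst hd
    intro k
    have : k = 0 := Subsingleton.elim _ _
    rw [this]; exact h0
  have hdot : ∀ (k : Fin d → ℤ) (j : Fin d) (c : ℤ),
      (∑ i, k i * (Pi.single j c : Fin d → ℤ) i) = k j * c := by
    intro k j c
    rw [Finset.sum_eq_single j] <;> simp +contextual
  have hs1 : ∀ (k : Fin d → ℤ) (j : Fin d), T (Pi.single j 1) → T k → k j ≠ 0 →
      T (k + Pi.single j 1) := fun k j hj hk hk0 => hadd _ _ hk hj (by rw [hdot]; simpa using hk0)
  have hs2 : ∀ (k : Fin d → ℤ) (j : Fin d), T (Pi.single j 1) → T k → k j ≠ 0 →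
      T (k + Pi.single j (-1)) := fun k j hj hk hk0 => hadd _ _ hk
        (by have := hneg _ hj; rwa [← Pi.single_neg] at this) (by rw [hdot]; simpa using hk0)
  have step1 : ∀ s : Finset (Fin d), (∀ j ∈ s, (j : ℕ) < d - 1) →
      T (fun i => if i ∈ s then 0 else 1) := by
    intro s
    induction s using Finset.induction_on with
    | empty => intro _; simpa using h1 hd
    | insert j s hj ih =>
      intro hs
      have h3 := hs2 _ j (hb j (hs j (Finset.mem_insert_self j s)))
        (ih fun i hi => hs i (Finset.mem_insert_of_mem hi)) (by simp [hj])
      convert h3 using 1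
      funext i
      by_cases hij : i = j
      · subst hij; simp [hj]
      · simp [hij]
  have he : ∀ j, T (Pi.single j 1) := by
    intro j
    by_cases hj : (j : ℕ) < d - 1
    · exact hb j hj
    · have := step1 (Finset.univ.filter fun i : Fin d => (i : ℕ) < d - 1) (by simp)
      convert this using 1
      funext i
      by_cases hij : i = j
      · subst hij; simp [hj]
      · have h5 : (i : ℕ) < d - 1 := by
          have : (i : ℕ) ≠ j := fun h => hij (Fin.ext h)
          omega
        simp [hij, h5]
  have he2 : ∀ j, T (Pi.single j (-2)) := by
    intro j
    have h2 := hneg _ (hs1 _ j (he j) (he j) (by simp))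
    convert h2 using 1
    funext i
    by_cases hij : i = j
    · subst hij; simp
    · simp [hij]
  have hup : ∀ (k : Fin d → ℤ) (j : Fin d), k j = 1 → T k → ∀ t, T (Function.update k j t) := by
    intro k j hkj hk t
    have hupd : ∀ a b : ℤ, Function.update k j a + Pi.single j b = Function.update k j (a + b) := by
      intro a b
      funext i
      by_cases hij : i = j
      · subst hij; simp
      · simp [hij]
    have hk1 : Function.update k j 1 = k := by rw [← hkj]; simp
    have hpos : ∀ n : ℕ, T (Function.update k j (1 + n)) := by
      intro n
      induction n with
      | zero => simpa [hk1] using hk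
      | succ n ih =>
        have := hs1 _ j (he j) ih (by simp; omega)
        rw [hupd] at this
        convert this using 2
        push_cast; ring
    have hm1 : T (Function.update k j (-1)) := by
      have := hadd _ _ hk (he2 j) (by rw [hdot]; simp [hkj])
      rw [← hk1, hupd] at this
      exact this
    have hm : ∀ n : ℕ, T (Function.update k j (-1 - n)) := by
      intro n
      induction n with
      | zero => simpa using hm1
      | succ n ih =>
        have := hs2 _ j (he j) ih (by simp; omega)
        rw [hupd] at this
        convert this using 2
        push_cast; ring
    rcases lt_trichotomy t 0 with h | h | h
    · have := hm (-1 - t).toNat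
      convert this using 2
      omega
    · have := hs2 _ j (he j) hk (by simp [hkj])
      rw [← hk1, hupd] at this
      rw [h]; exact this
    · have := hpos (t - 1).toNat
      convert this using 2
      omega
  have fin : ∀ (k : Fin d → ℤ) (s : Finset (Fin d)), T (fun i => if i ∈ s then k i else 1) := by
    intro k s
    induction s using Finset.induction_on with
    | empty => simpa using h1 hd
    | insert j s hj ih =>
      have := hup _ j (by simp [hj]) ih (k j)
      convert this using 1
      funext i
      by_cases hij : i = j
      · subst hij; simp
      · simp [hij]
  intro k
  simpa using fin k Finset.univ

variable {d : ℕ}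

lemma vshear_add {f g : (Fin d → ℝ) → ℝ} (hf : ContDiff ℝ ∞ f) (hg : ContDiff ℝ ∞ g) :
    vshear g ∘ vshear f = vshear (fun q => f q + g q) := by
  funext x
  simp only [Function.comp, vshear_eq, gr_add hf hg]
  rw [sub_sub]

/-- Potentials whose shear is approximately reachable in time zero. -/
def VS (V0 : (Fin d → ℝ) → ℝ) (f : (Fin d → ℝ) → ℝ) : Prop :=
  ContDiff ℝ ∞ f ∧ AR (torusHam V0) 0 (vshear f)

/-- Potentials all of whose multiples are in `VS`. -/
def LS (V0 : (Fin d → ℝ) → ℝ) (f : (Fin d → ℝ) → ℝ) : Prop :=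
  ContDiff ℝ ∞ f ∧ ∀ c : ℝ, AR (torusHam V0) 0 (vshear fun q => c * f q)

variable {V0 : (Fin d → ℝ) → ℝ}

lemma VS.add {f g : (Fin d → ℝ) → ℝ} (hf : VS V0 f) (hg : VS V0 g) :
    VS V0 (fun q => f q + g q) := by
  refine ⟨hf.1.add hg.1, ?_⟩
  have := hf.2.comp hg.2
  rwa [vshear_add hf.1 hg.1, add_zero] at this

lemma LS.vs {f : (Fin d → ℝ) → ℝ} (hf : LS V0 f) : VS V0 f :=
  ⟨hf.1, by simpa using hf.2 1⟩

lemma LS.of_vs {f : (Fin d → ℝ) → ℝ} (hf : ContDiff ℝ ∞ f)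
    (h : ∀ c : ℝ, VS V0 (fun q => c * f q)) : LS V0 f := ⟨hf, fun c => (h c).2⟩

lemma LS.smul {f : (Fin d → ℝ) → ℝ} (hf : LS V0 f) (c : ℝ) : LS V0 (fun q => c * f q) := by
  refine ⟨contDiff_const.mul hf.1, fun b => ?_⟩
  have := hf.2 (b * c)
  simpa only [mul_assoc] using this

lemma LS.add {f g : (Fin d → ℝ) → ℝ} (hf : LS V0 f) (hg : LS V0 g) :
    LS V0 (fun q => f q + g q) := by
  refine LS.of_vs (hf.1.add hg.1) fun c => ?_
  have := (hf.smul c).vs.add (hg.smul c).vs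
  simpa only [← mul_add] using this

lemma VS.const (c : ℝ) : VS V0 (fun _ => c) := by
  refine ⟨contDiff_const, ?_⟩
  have : vshear (fun _ : Fin d → ℝ => c) = id := by
    funext x
    refine Prod.ext rfl ?_
    funext i
    simp [vshear]
  rw [this]
  refine AR.of_reachable le_rfl ⟨0, Fin.elim0, Fin.elim0, Fin.elim0, ?_, ?_, ?_, ?_⟩ contDiff_id
  · exact fun i => i.elim0
  · simp
  · exact fun i => i.elim0
  · simp

lemma LS.const (c : ℝ) : LS V0 (fun _ => c) :=
  LS.of_vs contDiff_const fun _ => VS.const _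

lemma LS.kin (hV : PerSm V0) {g : (Fin d → ℝ) → ℝ} (hg : LS V0 g) : VS V0 (kin g) := by
  refine ⟨kin_smooth hg.1, ?_⟩
  have := AR_key hV hg.1 hg.2 (fun _ => 0)
  simpa [Wp] using this

lemma LS.Wp (hV : PerSm V0) (u : Fin d → ℝ × ℝ) : LS V0 (Wp u) := by
  refine ⟨Wp_smooth u, fun c => ?_⟩
  have := AR_key hV (g := fun _ => 0) contDiff_const (LS.const 0).2 (fun j => c • u j)
  simpa only [Wp_smul, TorusCtl.kin, gr, fderiv_fun_const, Pi.zero_apply,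
    zero_apply, ne_eq, OfNat.ofNat_ne_zero, not_false_eq_true, zero_pow,
    Finset.sum_const_zero, zero_div, add_zero] using this

/-- The phase `k·q + α`. -/
def ph (k : Fin d → ℤ) (α : ℝ) (q : Fin d → ℝ) : ℝ := (∑ i, (k i : ℝ) * q i) + α

lemma ph_smooth (k : Fin d → ℤ) (α : ℝ) : ContDiff ℝ ∞ (ph k α) := by
  unfold ph; fun_prop

lemma cosph_smooth (k : Fin d → ℤ) (α : ℝ) : ContDiff ℝ ∞ (fun q => Real.cos (ph k α q)) :=
  Real.contDiff_cos.comp (ph_smooth k α)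

lemma gr_cosph (k : Fin d → ℤ) (α : ℝ) (q : Fin d → ℝ) (i : Fin d) :
    gr (fun q => Real.cos (ph k α q)) q i = -(Real.sin (ph k α q) * k i) := by
  have h1 : HasFDerivAt (ph k α) (∑ i, (k i : ℝ) •
      ContinuousLinearMap.proj (R := ℝ) (φ := fun _ : Fin d => ℝ) i) q := by
    have h2 : HasFDerivAt (fun q : Fin d → ℝ => ∑ i, (k i : ℝ) * q i) _ q :=
      HasFDerivAt.fun_sum (u := Finset.univ) fun j _ =>
        ((ContinuousLinearMap.proj (R := ℝ) (φ := fun _ : Fin d => ℝ) j).hasFDerivAt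
          (x := q)).const_mul (k j : ℝ)
    exact h2.add_const α
  have h2 := h1.cos
  simp only [gr]
  rw [h2.fderiv]
  simp [sum_apply, Pi.single_apply]

/-- The frequency `k` is available. -/
def TF (V0 : (Fin d → ℝ) → ℝ) (k : Fin d → ℤ) : Prop :=
  ∀ α : ℝ, LS V0 (fun q => Real.cos (ph k α q))

lemma kin_two (k l : Fin d → ℤ) (α β a b : ℝ) (q : Fin d → ℝ) :
    kin (fun q => a * Real.cos (ph k α q) + b * Real.cos (ph l β q)) q =
      a ^ 2 * (∑ i, (k i : ℝ) ^ 2) / 2 * Real.sin (ph k α q) ^ 2 +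
      b ^ 2 * (∑ i, (l i : ℝ) ^ 2) / 2 * Real.sin (ph l β q) ^ 2 +
      a * b * (∑ i, (k i : ℝ) * l i) * (Real.sin (ph k α q) * Real.sin (ph l β q)) := by
  unfold kin
  rw [gr_add (contDiff_const.mul (cosph_smooth k α)) (contDiff_const.mul (cosph_smooth l β)),
    gr_smul (cosph_smooth k α), gr_smul (cosph_smooth l β)]
  simp only [Pi.add_apply, Pi.smul_apply, gr_cosph, smul_eq_mul]
  simp only [Finset.mul_sum, Finset.sum_div, Finset.sum_mul, ← Finset.sum_add_distrib]
  refine Finset.sum_congr rfl fun i _ => ?_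
  ring

lemma ph_shift (k : Fin d → ℤ) (α β : ℝ) (q : Fin d → ℝ) : ph k (α + β) q = ph k α q + β := by
  unfold ph; ring

lemma sinsin (hV : PerSm V0) {k l : Fin d → ℤ} (hk : TF V0 k) (hl : TF V0 l)
    (hkl : (∑ i, k i * l i) ≠ 0) (α β : ℝ) :
    LS V0 (fun q => Real.sin (ph k α q) * Real.sin (ph l β q)) := by
  refine LS.of_vs ((Real.contDiff_sin.comp (ph_smooth k α)).mul
    (Real.contDiff_sin.comp (ph_smooth l β))) fun c => ?_
  have hD : (∑ i, (k i : ℝ) * l i) ≠ 0 := by exact_mod_cast hkl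
  set D := ∑ i, (k i : ℝ) * l i with hDd
  have v1 := LS.kin hV (((hk α).smul (c / D)).add ((hl β).smul 1))
  have v2 := LS.kin hV (((hk (α + π / 2)).smul (c / D)).add ((hl β).smul 0))
  have v3 := LS.kin hV (((hk α).smul 0).add ((hl (β + π / 2)).smul 1))
  have v4 := VS.const (V0 := V0) (-((c / D) ^ 2 * (∑ i, (k i : ℝ) ^ 2) / 2 +
    1 ^ 2 * (∑ i, (l i : ℝ) ^ 2) / 2))
  have := ((v1.add v2).add v3).add v4
  convert this using 2 with q
  rw [kin_two, kin_two, kin_two, ph_shift, ph_shift, Real.sin_add_pi_div_two,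
    Real.sin_add_pi_div_two, Real.cos_sq', Real.cos_sq', ← hDd]
  field_simp
  ring

lemma TF.neg {k : Fin d → ℤ} (hk : TF V0 k) : TF V0 (-k) := by
  intro α
  have := hk (-α)
  convert this using 2 with q
  rw [← Real.cos_neg]
  congr 1
  simp [ph]
  ring

lemma TF.add (hV : PerSm V0) {k l : Fin d → ℤ} (hk : TF V0 k) (hl : TF V0 l)
    (hkl : (∑ i, k i * l i) ≠ 0) : TF V0 (k + l) := by
  intro α
  have h1 := sinsin hV hk hl hkl (α + π / 2) (0 + π / 2)
  have h2 := (sinsin hV hk hl hkl α 0).smul (-1)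
  have := h1.add h2
  convert this using 2 with q
  rw [ph_shift, ph_shift, Real.sin_add_pi_div_two, Real.sin_add_pi_div_two]
  have : ph (k + l) α q = ph k α q + ph l 0 q := by
    simp only [ph, Pi.add_apply, Int.cast_add, add_mul, Finset.sum_add_distrib]
    ring
  rw [this, Real.cos_add]
  ring

lemma TF.base (hV : PerSm V0) {k : Fin d → ℤ} (j : Fin d) (hk : ∀ i, kvec d j i = k i) :
    TF V0 k := by
  classical
  intro α
  have := LS.Wp hV (Pi.single j (Real.cos α, -Real.sin α))
  convert this using 2 with q
  unfold TorusCtl.Wp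
  rw [Finset.sum_eq_single j]
  · simp only [ph, hk, Pi.single_eq_same, Real.cos_add]
    ring
  · intro i _ hi
    simp [hi]
  · simp

theorem TF.all (hV : PerSm V0) : ∀ k : Fin d → ℤ, TF V0 k := by
  refine freq_all (TF V0) ?_ (fun k h => h.neg) (fun k l hk hl h => TF.add hV hk hl h) ?_ ?_
  · intro α
    simpa [ph] using LS.const (V0 := V0) (Real.cos α)
  · intro j hj
    refine TF.base hV j fun i => ?_
    simp only [kvec, if_pos hj]
    by_cases h : i = j
    · subst h; simp
    · simp [h]
  · intro hd
    refine TF.base hV ⟨d - 1, by omega⟩ fun i => ?_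
    simp [kvec]

end AlgPart
end TorusCtl

open MeasureTheory Real
set_option linter.unusedSectionVars false
namespace TorusCtl
noncomputable section DensPart
open Set Filter Topology
open scoped ContDiff NNReal

variable {d : ℕ}

/-- Vector-valued periodicity. -/
def Per {G : Type} (F : (Fin d → ℝ) → G) : Prop :=
  ∀ (q : Fin d → ℝ) (k : Fin d → ℤ), F (fun i => q i + 2 * Real.pi * (k i)) = F q

/-- Convolution in the variable `j`. -/
def Tv {G : Type} [NormedAddCommGroup G] [NormedSpace ℝ G] (j : Fin d) (w : ℝ → ℝ)
    (F : (Fin d → ℝ) → G) (q : Fin d → ℝ) : G :=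
  ∫ y in (-π)..π, w y • F (q - Pi.single j y)

section
variable {G : Type} [NormedAddCommGroup G] [NormedSpace ℝ G]

lemma cont_integrand {w : ℝ → ℝ} (hw : Continuous w) {F : (Fin d → ℝ) → G} (hF : Continuous F)
    (j : Fin d) (q : Fin d → ℝ) : Continuous fun y => w y • F (q - Pi.single j y) :=
  hw.smul (hF.comp (continuous_const.sub (continuous_single (A := fun _ : Fin d => ℝ) j)))

lemma Tv_hasFDerivAt {w : ℝ → ℝ} (hw : Continuous w) {F : (Fin d → ℝ) → G}
    (hF : ContDiff ℝ ∞ F) (hp : Per F) (j : Fin d) (q : Fin d → ℝ) :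
    HasFDerivAt (Tv j w F) (Tv j w (fderiv ℝ F) q) q := by
  obtain ⟨C, hC⟩ := periodic_bounded (smooth_fderiv hF).continuous (fderiv_periodic hp)
  unfold Tv
  refine intervalIntegral.hasFDerivAt_integral_of_dominated_of_fderiv_le (s := univ)
    (bound := fun y => ‖w y‖ * C) (F := fun q y => w y • F (q - Pi.single j y))
    (F' := fun q y => w y • fderiv ℝ F (q - Pi.single j y)) univ_mem ?_ ?_ ?_ ?_ ?_ ?_
  · exact Eventually.of_forall fun x => (cont_integrand hw hF.continuous j x).aestronglyMeasurable
  · exact (cont_integrand hw hF.continuous j q).intervalIntegrable _ _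
  · exact (cont_integrand hw (smooth_fderiv hF).continuous j q).aestronglyMeasurable
  · refine Eventually.of_forall fun t _ x _ => ?_
    rw [norm_smul]
    exact mul_le_mul_of_nonneg_left (by exact_mod_cast hC _) (norm_nonneg _)
  · exact (hw.norm.mul continuous_const).intervalIntegrable _ _
  · refine Eventually.of_forall fun t _ x _ => ?_
    have h1 := (smooth_diff hF (x - Pi.single j t)).hasFDerivAt
    have h2 : HasFDerivAt (fun x => F (x - Pi.single j t)) (fderiv ℝ F (x - Pi.single j t)) x :=
      by
      have h0 := h1.comp x ((hasFDerivAt_id x).sub_const (Pi.single j t))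
      rw [ContinuousLinearMap.comp_id] at h0
      exact h0
    exact h2.const_smul (w t)

lemma Tv_fderiv {w : ℝ → ℝ} (hw : Continuous w) {F : (Fin d → ℝ) → G}
    (hF : ContDiff ℝ ∞ F) (hp : Per F) (j : Fin d) :
    fderiv ℝ (Tv j w F) = Tv j w (fderiv ℝ F) :=
  funext fun q => (Tv_hasFDerivAt hw hF hp j q).fderiv
end

lemma Tv_smooth {w : ℝ → ℝ} (hw : Continuous w) (j : Fin d) {G : Type} [NormedAddCommGroup G]
    [NormedSpace ℝ G] {F : (Fin d → ℝ) → G}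
    (hF : ContDiff ℝ ∞ F) (hp : Per F) : ContDiff ℝ ∞ (Tv j w F) := by
  have key : ∀ n : ℕ, ∀ {G : Type} [NormedAddCommGroup G]
    [NormedSpace ℝ G] {F : (Fin d → ℝ) → G}, ContDiff ℝ ∞ F → Per F →
      ContDiff ℝ n (Tv j w F) := by
    intro n
    induction n with
    | zero =>
      intro G _ _ F hF hp
      exact contDiff_zero.2 (continuous_iff_continuousAt.2 fun q =>
        (Tv_hasFDerivAt hw hF hp j q).continuousAt)
    | succ n ih =>
      intro G _ _ F hF hp
      push_cast
      rw [contDiff_succ_iff_fderiv]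
      refine ⟨fun q => (Tv_hasFDerivAt hw hF hp j q).differentiableAt, by simp, ?_⟩
      rw [Tv_fderiv hw hF hp j]
      exact ih (smooth_fderiv hF) (fderiv_periodic hp)
  exact contDiff_infty.2 fun n => key n hF hp

/-- The peak kernel. -/
def wn (n : ℕ) (y : ℝ) : ℝ := (∫ y in (-π)..π, (1 + Real.cos y) ^ n)⁻¹ * (1 + Real.cos y) ^ n

lemma wn_cont (n : ℕ) : Continuous (wn n) := by unfold wn; fun_prop

lemma wn_nonneg (n : ℕ) (y : ℝ) : 0 ≤ wn n y := by
  have h : ∀ y, 0 ≤ 1 + Real.cos y := fun y => by linarith [Real.neg_one_le_cos y]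
  unfold wn
  refine mul_nonneg (inv_nonneg.2 ?_) (pow_nonneg (h y) n)
  exact intervalIntegral.integral_nonneg (by linarith [Real.pi_pos]) fun y _ => pow_nonneg (h y) n

lemma wn_integral (n : ℕ) : ∫ y in (-π)..π, wn n y = 1 := by
  unfold wn
  rw [intervalIntegral.integral_const_mul]
  refine inv_mul_cancel₀ (ne_of_gt ?_)
  refine intervalIntegral.integral_pos (by linarith [Real.pi_pos]) (by fun_prop)
    (fun y _ => pow_nonneg (by linarith [Real.neg_one_le_cos y]) n)
    ⟨0, ⟨by linarith [Real.pi_pos], Real.pi_pos.le⟩, by simp⟩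

lemma wn_peak : Tendsto (fun n => ∫ y in (-π)..π, wn n y * |y|) atTop (𝓝 0) := by
  have h := tendsto_setIntegral_pow_smul_of_unique_maximum_of_isCompact_of_continuousOn
    (μ := volume) (s := Icc (-π) π) (x₀ := 0) (c := fun y => 1 + Real.cos y) (g := fun y : ℝ => |y|)
    isCompact_Icc (by fun_prop) (fun y hy h0 => ?_)
    (fun y _ => by linarith [Real.neg_one_le_cos y]) (by simp) ?_ (by fun_prop)
  · rw [abs_zero] at h
    refine h.congr fun n => ?_
    have e : (-π : ℝ) ≤ π := by linarith [Real.pi_pos]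
    simp only [wn, mul_assoc, intervalIntegral.integral_const_mul]
    rw [intervalIntegral.integral_of_le e, intervalIntegral.integral_of_le e,
      integral_Icc_eq_integral_Ioc, integral_Icc_eq_integral_Ioc]
    simp
  · simp only [Real.cos_zero]
    have h1 : Real.cos y ≠ 1 := by
      intro h
      have := (Real.cos_eq_one_iff_of_lt_of_lt (by linarith [hy.1, Real.pi_pos])
        (by linarith [hy.2, Real.pi_pos])).1 h
      exact h0 this
    linarith [lt_of_le_of_ne (Real.cos_le_one y) h1]
  · refine subset_closure ?_
    rw [interior_Icc]
    exact ⟨by linarith [Real.pi_pos], Real.pi_pos⟩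

lemma Tv_cv0 (j : Fin d) {G : Type} [NormedAddCommGroup G]
    [NormedSpace ℝ G] [CompleteSpace G] {F : (Fin d → ℝ) → G} (hF : ContDiff ℝ ∞ F) (hp : Per F) :
    Cv0 atTop (fun n => Tv j (wn n) F) F := by
  obtain ⟨C, hC⟩ := periodic_bounded (smooth_fderiv hF).continuous (fderiv_periodic hp)
  have hL : LipschitzWith C F := lipschitzWith_of_nnnorm_fderiv_le (smooth_diff hF) hC
  have e : (-π : ℝ) ≤ π := by linarith [Real.pi_pos]
  have hb : ∀ n q, ‖Tv j (wn n) F q - F q‖ ≤ C * ∫ y in (-π)..π, wn n y * |y| := by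
    intro n q
    have h1 : F q = ∫ y in (-π)..π, wn n y • F q := by
      rw [intervalIntegral.integral_smul_const, wn_integral, one_smul]
    have h2 : Tv j (wn n) F q - F q =
        ∫ y in (-π)..π, wn n y • (F (q - Pi.single j y) - F q) := by
      conv_lhs => rw [h1]
      unfold Tv
      rw [← intervalIntegral.integral_sub]
      · simp only [smul_sub]
      · exact (cont_integrand (wn_cont n) hF.continuous j q).intervalIntegrable _ _
      · exact ((wn_cont n).smul continuous_const).intervalIntegrable _ _
    rw [h2, ← intervalIntegral.integral_const_mul]
    refine intervalIntegral.norm_integral_le_of_norm_le e (Eventually.of_forall fun y _ => ?_) ?_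
    · rw [norm_smul, Real.norm_of_nonneg (wn_nonneg n y)]
      have h3 := hL.dist_le_mul (q - Pi.single j y) q
      rw [dist_eq_norm, dist_eq_norm] at h3
      have h4 : ‖q - Pi.single j y - q‖ = |y| := by
        rw [sub_sub_cancel_left, norm_neg, Pi.norm_single, Real.norm_eq_abs]
      rw [h4] at h3
      nlinarith [mul_le_mul_of_nonneg_left h3 (wn_nonneg n y)]
    · exact (continuous_const.mul ((wn_cont n).mul continuous_abs)).intervalIntegrable _ _
  intro x
  have h5 : Tendsto (fun z : ℕ × (Fin d → ℝ) => Tv j (wn z.1) F z.2 - F z.2)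
      (atTop ×ˢ 𝓝 x) (𝓝 0) := by
    refine squeeze_zero_norm (fun z => hb z.1 z.2) ?_
    have := (wn_peak.const_mul (C:ℝ)).comp (tendsto_fst (f := atTop) (g := 𝓝 x))
    rw [mul_zero] at this
    exact this
  have h6 := h5.add ((hF.continuous.tendsto x).comp (tendsto_snd (f := (atTop : Filter ℕ))))
  simpa [Function.comp] using h6

lemma Tv_cv (j : Fin d) (k : ℕ) : ∀ {G : Type} [NormedAddCommGroup G]
    [NormedSpace ℝ G] [CompleteSpace G] {F : (Fin d → ℝ) → G}, ContDiff ℝ ∞ F → Per F →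
    Cv atTop k (fun n => Tv j (wn n) F) F := by
  induction k with
  | zero => intro G _ _ _ F hF hp; exact Tv_cv0 j hF hp
  | succ k ih =>
    intro G _ _ _ F hF hp
    refine ⟨Tv_cv0 j hF hp, ?_⟩
    simp only [Tv_fderiv (wn_cont _) hF hp]
    exact ih (smooth_fderiv hF) (fderiv_periodic hp)

end DensPart
end TorusCtl

open MeasureTheory Real
set_option linter.unusedSectionVars false
namespace TorusCtl
noncomputable section FinPart
open Set Filter Topology
open scoped ContDiff NNReal

variable {d : ℕ} {V0 : (Fin d → ℝ) → ℝ}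

/-- The linear part of a shear. -/
def JJ : ((Fin d → ℝ) →L[ℝ] ℝ) →L[ℝ] Phase d :=
  (0 : ((Fin d → ℝ) →L[ℝ] ℝ) →L[ℝ] (Fin d → ℝ)).prod
    (ContinuousLinearMap.pi fun i => -(ContinuousLinearMap.apply ℝ ℝ (Pi.single i 1 : Fin d → ℝ)))

lemma vshear_JJ (f : (Fin d → ℝ) → ℝ) : vshear f = fun x => x + JJ (fderiv ℝ f x.1) := by
  funext x
  refine Prod.ext ?_ ?_
  · simp [vshear, JJ]
  · funext i
    simp [vshear, JJ, sub_eq_add_neg]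

lemma Cv_vshear {F : ℕ → (Fin d → ℝ) → ℝ} {f : (Fin d → ℝ) → ℝ} (sF : ∀ n, ContDiff ℝ ∞ (F n))
    (sf : ContDiff ℝ ∞ f) (h : ∀ k, Cv atTop k F f) (k : ℕ) :
    Cv atTop k (fun n => vshear (F n)) (vshear f) := by
  have h1 : Cv atTop k (fun n => fderiv ℝ (F n)) (fderiv ℝ f) := (h (k + 1)).2
  have h2 : Cv atTop k (fun n (x : Phase d) => fderiv ℝ (F n) x.1) (fun x => fderiv ℝ f x.1) :=
    Cv.comp (A := fun _ (x : Phase d) => x.1) (a := fun x => x.1)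
      (B := fun n => fderiv ℝ (F n)) (fun _ => contDiff_fst)
      (fun n => smooth_fderiv (sF n)) contDiff_fst (smooth_fderiv sf) (Cv.const contDiff_fst) h1
  have s2 : ∀ n, ContDiff ℝ ∞ (fun x : Phase d => fderiv ℝ (F n) x.1) :=
    fun n => (smooth_fderiv (sF n)).comp contDiff_fst
  have s3 : ContDiff ℝ ∞ (fun x : Phase d => fderiv ℝ f x.1) := (smooth_fderiv sf).comp contDiff_fst
  have h3 : Cv atTop k (fun n (x : Phase d) => JJ (fderiv ℝ (F n) x.1))
      (fun x => JJ (fderiv ℝ f x.1)) :=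
    Cv.comp (A := fun n (x : Phase d) => fderiv ℝ (F n) x.1) (a := fun x => fderiv ℝ f x.1)
      (B := fun _ y => JJ y) (b := fun y => JJ y) s2
      (fun _ => JJ.contDiff) s3 JJ.contDiff h2 (Cv.const JJ.contDiff)
  have h4 := Cv.add (A := fun _ (x : Phase d) => x) (a := fun x => x) (fun _ => contDiff_id)
    (fun n => JJ.contDiff.comp (s2 n))
    contDiff_id (JJ.contDiff.comp s3) (Cv.const contDiff_id) h3
  simp only [vshear_JJ]
  exact h4

lemma LS.closed {F : ℕ → (Fin d → ℝ) → ℝ} {f : (Fin d → ℝ) → ℝ} (hF : ∀ n, LS V0 (F n))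
    (sf : ContDiff ℝ ∞ f) (h : ∀ k, Cv atTop k F f) : LS V0 f := by
  refine ⟨sf, fun c => ?_⟩
  have sc : ContDiff ℝ ∞ (fun y : ℝ => c * y) := by fun_prop
  refine AR.closed (τ := fun _ => 0) tendsto_const_nhds (fun n => (hF n).2 c)
    (vshear_smooth (contDiff_const.mul sf)) (Cv_vshear (fun n => contDiff_const.mul (hF n).1)
      (contDiff_const.mul sf) fun k => ?_)
  exact Cv.comp (A := F) (a := f) (B := fun _ y => c * y) (b := fun y => c * y)
    (fun n => (hF n).1) (fun _ => sc) sf sc (h k) (Cv.const sc)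

/-- Trigonometric polynomials of one variable. -/
inductive TP : (ℝ → ℝ) → Prop
  | basic (m : ℤ) (β : ℝ) : TP (fun y => Real.cos (m * y + β))
  | add {p r : ℝ → ℝ} : TP p → TP r → TP (fun y => p y + r y)
  | smul (c : ℝ) {p : ℝ → ℝ} : TP p → TP (fun y => c * p y)

lemma TP.cont {p : ℝ → ℝ} (h : TP p) : Continuous p := by
  induction h with
  | basic m β => fun_prop
  | add _ _ h1 h2 => exact h1.add h2
  | smul c _ h1 => exact continuous_const.mul h1

lemma TP.cos_mul {p : ℝ → ℝ} (h : TP p) : TP (fun y => Real.cos y * p y) := by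
  induction h with
  | basic m β =>
    have := (TP.smul (1/2) (TP.basic (m + 1) β)).add (TP.smul (1/2) (TP.basic (m - 1) β))
    convert this using 2 with y
    push_cast
    have e1 : ((m:ℝ) + 1) * y + β = (m * y + β) + y := by ring
    have e2 : ((m:ℝ) - 1) * y + β = (m * y + β) - y := by ring
    rw [e1, e2, Real.cos_add _ y, Real.cos_sub _ y]
    ring
  | add _ _ h1 h2 =>
    convert h1.add h2 using 2 with y
    ring
  | smul c _ h1 =>
    convert h1.smul c using 2 with y
    ring

lemma TP.wn (n : ℕ) : TP (wn n) := by
  refine TP.smul _ ?_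
  induction n with
  | zero => simpa using TP.basic 0 0
  | succ n ih =>
    convert ih.add ih.cos_mul using 2 with y
    ring

/-- Independence of the variables in `s`. -/
def Indep (s : Finset (Fin d)) (g : (Fin d → ℝ) → ℝ) : Prop :=
  ∀ q q', (∀ i, i ∉ s → q i = q' i) → g q = g q'

/-- Freeze coordinate `j` at zero. -/
def P0 (j : Fin d) : (Fin d → ℝ) →L[ℝ] (Fin d → ℝ) :=
  ContinuousLinearMap.id ℝ _ - (ContinuousLinearMap.single ℝ (fun _ : Fin d => ℝ) j).comp
    (ContinuousLinearMap.proj j)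

lemma P0_apply (j : Fin d) (q : Fin d → ℝ) : P0 j q = q - Pi.single j (q j) := rfl

lemma frozen_good {s : Finset (Fin d)} {g : (Fin d → ℝ) → ℝ} (hg : PerSm g) (hi : Indep s g)
    (j : Fin d) {w : ℝ → ℝ} (hw : Continuous w) :
    PerSm (fun q => Tv j w g (P0 j q)) ∧ Indep (insert j s) (fun q => Tv j w g (P0 j q)) := by
  refine ⟨⟨(Tv_smooth hw j hg.1 hg.2).comp (P0 j).contDiff, fun q k => ?_⟩, fun q q' h => ?_⟩
  · simp only [Tv]
    congr 1
    funext y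
    congr 1
    refine Eq.trans ?_ (hg.2 _ (Function.update k j 0))
    congr 1
    funext i
    by_cases h : i = j
    · subst h; simp [P0_apply]
    · simp [P0_apply, h]
  · simp only [Tv]
    congr 1
    funext y
    congr 1
    refine hi _ _ fun i his => ?_
    by_cases hij : i = j
    · subst hij; simp [P0_apply]
    · simp [P0_apply, hij, h i (by simp [hij, his])]

lemma Tv_cos {g : (Fin d → ℝ) → ℝ} (hg : PerSm g) (j : Fin d) (m : ℤ) (β : ℝ) (q : Fin d → ℝ) :
    Tv j (fun y => Real.cos (m * y + β)) g q =
      Real.cos (m * q j) * Tv j (fun y => Real.cos (m * y + β)) g (P0 j q) +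
      Real.cos (m * q j + π / 2) * Tv j (fun y => Real.cos (m * y + (β - π / 2))) g (P0 j q) := by
  have hper : Function.Periodic (fun y => Real.cos (m * y + β) • g (q - Pi.single j y)) (2 * π) := by
    intro y
    have e1 : (m:ℝ) * (y + 2 * π) + β = (m * y + β) + m * (2 * π) := by ring
    simp only []
    rw [e1, Real.cos_add_int_mul_two_pi, ← hg.2 _ (Pi.single j 1)]
    congr 2
    funext i
    by_cases h : i = j
    · subst h; simp; try ring
    · simp [h]
  have hc : ∀ β, Continuous fun y : ℝ => Real.cos (m * y + β) := fun β => by fun_prop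
  have h1 := hper.intervalIntegral_add_eq (-π) (-π + q j)
  have e2 : -π + 2 * π = π := by ring
  have e3 : -π + q j + 2 * π = π + q j := by ring
  rw [e2, e3] at h1
  unfold Tv
  rw [h1, ← intervalIntegral.integral_comp_add_right, ← intervalIntegral.integral_const_mul,
    ← intervalIntegral.integral_const_mul, ← intervalIntegral.integral_add]
  · congr 1
    funext y
    have e4 : q - Pi.single j (y + q j) = P0 j q - Pi.single j y := by
      rw [P0_apply, Pi.single_add]; abel
    rw [e4]
    have e5 : (m:ℝ) * (y + q j) + β = m * q j + (m * y + β) := by ring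
    have e6 : (m:ℝ) * y + (β - π / 2) = (m * y + β) - π / 2 := by ring
    simp only [smul_eq_mul]
    rw [e5, e6, Real.cos_sub_pi_div_two, Real.cos_add_pi_div_two,
      Real.cos_add (m * q j) (m * y + β)]
    ring
  · exact (continuous_const.mul
      (cont_integrand (hc _) hg.1.continuous j (P0 j q))).intervalIntegrable _ _
  · exact (continuous_const.mul
      (cont_integrand (hc _) hg.1.continuous j (P0 j q))).intervalIntegrable _ _

lemma ph_add_single (k : Fin d → ℤ) (α : ℝ) (j : Fin d) (m : ℤ) (q : Fin d → ℝ) :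
    ph (k + Pi.single j m) α q = ph k α q + m * q j := by
  classical
  unfold ph
  have : ∀ i, (((k + Pi.single j m : Fin d → ℤ) i : ℤ) : ℝ) * q i = k i * q i + if i = j then m * q j else 0 := by
    intro i
    by_cases h : i = j
    · subst h; simp; ring
    · simp [h]
  simp only [this, Finset.sum_add_distrib, Finset.sum_ite_eq', Finset.mem_univ, if_true]
  ring

theorem dens (hV : PerSm V0) (s : Finset (Fin d)) : ∀ (t : Finset (Fin d)), sᶜ = t →
    ∀ (k : Fin d → ℤ) (α : ℝ) (g : (Fin d → ℝ) → ℝ), PerSm g → Indep s g →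
      LS V0 (fun q => Real.cos (ph k α q) * g q) := by
  classical
  intro t
  induction t using Finset.induction_on generalizing s with
  | empty =>
    intro hs k α g hg hi
    have hs' : s = Finset.univ := by simpa using hs
    have : ∀ q, g q = g 0 := fun q => hi _ _ (by simp [hs'])
    have h2 := (TF.all hV k α).smul (g 0)
    convert h2 using 2 with q
    rw [this q]; ring
  | insert j t hj ih =>
    intro hs k α g hg hi
    have hs2 : (insert j s)ᶜ = t := by
      ext i
      have h3 : i ∈ sᶜ ↔ i ∈ insert j t := by rw [hs]
      simp only [Finset.mem_compl, Finset.mem_insert] at h3 ⊢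
      by_cases hij : i = j
      · subst hij; simp [hj]
      · simp only [hij, false_or] at h3 ⊢; exact h3
    have ih' := ih (insert j s) hs2
    have hmul : ∀ (k : Fin d → ℤ) (α : ℝ) (m : ℤ) (β : ℝ) (h : (Fin d → ℝ) → ℝ), PerSm h →
        Indep (insert j s) h →
        LS V0 (fun q => Real.cos (ph k α q) * (Real.cos (m * q j + β) * h q)) := by
      intro k α m β h hh hhi
      have h1 := ((ih' (k + Pi.single j m) (α + β) h hh hhi).smul (1/2)).add
        ((ih' (k + Pi.single j (-m)) (α + -β) h hh hhi).smul (1/2))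
      convert h1 using 2 with q
      rw [ph_add_single, ph_add_single, ph_shift, ph_shift]
      have e1 : ph k α q + β + m * q j = ph k α q + (m * q j + β) := by ring
      have e2 : ph k α q + -β + ((-m : ℤ) : ℝ) * q j = ph k α q - (m * q j + β) := by
        push_cast; ring
      rw [e1, e2, Real.cos_add (ph k α q) (m * q j + β), Real.cos_sub]
      ring
    have htp : ∀ p, TP p → LS V0 (fun q => Real.cos (ph k α q) * Tv j p g q) := by
      intro p hp
      induction hp with
      | basic m β =>
        have g1 := frozen_good hg hi j (w := fun y => Real.cos (m * y + β)) (by fun_prop)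
        have g2 := frozen_good hg hi j (w := fun y => Real.cos (m * y + (β - π / 2))) (by fun_prop)
        have h1 := (hmul k α m 0 _ g1.1 g1.2).add (hmul k α m (π / 2) _ g2.1 g2.2)
        convert h1 using 2 with q
        rw [Tv_cos hg]
        simp only [add_zero]
        ring
      | @add p r hp hr h1 h2 =>
        convert h1.add h2 using 2 with q
        have : Tv j (fun y => p y + r y) g q = Tv j p g q + Tv j r g q := by
          unfold Tv
          rw [← intervalIntegral.integral_add]
          · simp only [add_smul]
          · exact (cont_integrand hp.cont hg.1.continuous j q).intervalIntegrable _ _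
          · exact (cont_integrand hr.cont hg.1.continuous j q).intervalIntegrable _ _
        rw [this]; ring
      | @smul c p hp h1 =>
        convert h1.smul c using 2 with q
        have : Tv j (fun y => c * p y) g q = c * Tv j p g q := by
          unfold Tv
          rw [← intervalIntegral.integral_const_mul]
          simp only [smul_eq_mul, mul_assoc]
        rw [this]; ring
    refine LS.closed (fun n => htp (wn n) (TP.wn n)) ((cosph_smooth k α).mul hg.1) fun l => ?_
    exact Cv.bilin (ContinuousLinearMap.mul ℝ ℝ) (A := fun _ q => Real.cos (ph k α q))
      (a := fun q => Real.cos (ph k α q)) (B := fun n => Tv j (wn n) g) (b := g)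
      (fun _ => cosph_smooth k α) (fun n => Tv_smooth (wn_cont n) j hg.1 hg.2)
      (cosph_smooth k α) hg.1 (Cv.const (cosph_smooth k α)) (Tv_cv j l hg.1 hg.2)

theorem shear_AR (hV : PerSm V0) {f : (Fin d → ℝ) → ℝ} (hf : PerSm f) :
    AR (torusHam V0) 0 (vshear f) := by
  have h := dens hV ∅ _ rfl 0 0 f hf (fun q q' h => by
    have : q = q' := funext fun i => h i (by simp)
    rw [this])
  simpa [ph] using h.vs.2

end FinPart
end TorusCtl

/-- **Theorem (vertical shears on `T*𝕋^d` are small-time approximately reachable).**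
For the torus control system (lifted to `ℝ^d × ℝ^d`)
`H_u(q,p) = |p|²/2 + V_0(q) + Σ_{j=1}^d (u_{2j−1} cos(k_j·q) + u_{2j} sin(k_j·q))` with
`V_0` smooth and `2π`-periodic, every vertical shear `(q,p) ↦ (q, p − ∇f(q))` with
`f ∈ C^∞(ℝ^d,ℝ)` `2π`-periodic in each variable is small-time approximately reachable. -/
theorem torus_vertical_shears_reachable
    (d : ℕ) (V0 : (Fin d → ℝ) → ℝ) (hV0 : ContDiff ℝ (⊤ : ℕ∞) V0)
    (hper : ∀ (q : Fin d → ℝ) (k : Fin d → ℤ),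
      V0 (fun i => q i + 2 * Real.pi * (k i)) = V0 q) :
    ∀ f : (Fin d → ℝ) → ℝ, ContDiff ℝ (⊤ : ℕ∞) f →
      (∀ (q : Fin d → ℝ) (k : Fin d → ℤ),
        f (fun i => q i + 2 * Real.pi * (k i)) = f q) →
      SmallTimeReachable (torusHam V0) (vshear f) := by
  intro f hf hfp
  exact (TorusCtl.shear_AR (V0 := V0) ⟨hV0, hper⟩ ⟨hf, hfp⟩).small
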